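/- (Standard form, regular case.) Let n > 1 and let B be an n×n integer matrix with every entry strictly positive, with elementary divisors d₁ | d₂ | ⋯ | dₙ, let k = rank(−B), and set A = I + B. If det(−B) ≤ 0, then A ∼_M I + B', where B' is the n×n matrix with B'(1,c) = d_k for k ≤ c ≤ n and B'(1,c) = 0 for c < k; B'(i+1, i) = dᵢ for 1 ≤ i ≤ k−1, all other entries of rows 2, …, k being 0; and B'(r,c) = d_k for k+1 ≤ r ≤ n and k ≤ c ≤ n, all other entries of rows k+1, …, n being 0. -/

import Mathlib

/-- A directed graph as used in the theory of graph `C*`-algebras: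
a type of vertices, a type of edges, and range and source maps. -/
structure CKGraph : Type 1 where
  V : Type
  E : Type
  r : E → V
  s : E → V

namespace CKGraph

/-- An isomorphism of graphs: bijections of vertices and edges intertwining
the range and source maps. -/
structure Iso (G H : CKGraph) where
  vEquiv : G.V ≃ H.V
  eEquiv : G.E ≃ H.E
  map_r : ∀ e, H.r (eEquiv e) = vEquiv (G.r e)
  map_s : ∀ e, H.s (eEquiv e) = vEquiv (G.s e)

/-- A vertex is a source if it receives no edges. -/
def IsSource (G : CKGraph) (v : G.V) : Prop := ∀ e, G.r e ≠ v

/-- A vertex is a sink if it emits no edges. -/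
def IsSink (G : CKGraph) (v : G.V) : Prop := ∀ e, G.s e ≠ v

/-- A vertex is an infinite emitter if it emits infinitely many edges. -/
def IsInfiniteEmitter (G : CKGraph) (v : G.V) : Prop := {e | G.s e = v}.Infinite

/-- A vertex is regular if it is neither a sink nor an infinite emitter. -/
def Regular (G : CKGraph) (v : G.V) : Prop :=
  (∃ e, G.s e = v) ∧ {e | G.s e = v}.Finite

/-- There is a (nonempty) path from `u` to `v` in `G`. -/
inductive HasPath (G : CKGraph) : G.V → G.V → Prop
  | single (e : G.E) : HasPath G (G.s e) (G.r e)
  | cons (e : G.E) {v : G.V} : HasPath G (G.r e) v → HasPath G (G.s e) v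

/-- `G.Geq u v` is the relation `u ≥ v`: `u = v` or there is a path from `u` to `v`. -/
def Geq (G : CKGraph) (u v : G.V) : Prop := u = v ∨ G.HasPath u v

/-- There is a (nonempty) path from `u` to `v` all of whose vertices lie in `S`. -/
inductive HasPathIn (G : CKGraph) (S : Set G.V) : G.V → G.V → Prop
  | single (e : G.E) : G.s e ∈ S → G.r e ∈ S → HasPathIn G S (G.s e) (G.r e)
  | cons (e : G.E) {v : G.V} : G.s e ∈ S → HasPathIn G S (G.r e) v →
      HasPathIn G S (G.s e) v

/-- The nonempty list of edges `l` is a path from `u` to `v`. -/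
def IsPathFromTo (G : CKGraph) (l : List G.E) (u v : G.V) : Prop :=
  ∃ h : l ≠ [], l.Chain' (fun e f => G.r e = G.s f) ∧
    G.s (l.head h) = u ∧ G.r (l.getLast h) = v

/-- The list of edges `l` is a simple loop based at `v`: a loop at `v` such that the
range of every non-final edge is different from `v`. -/
def IsSimpleLoopAt (G : CKGraph) (v : G.V) (l : List G.E) : Prop :=
  G.IsPathFromTo l v v ∧ ∀ e ∈ l.dropLast, G.r e ≠ v

/-- A set of vertices is hereditary if it contains the range of every edge whose
source it contains. -/
def Hereditary (G : CKGraph) (H : Set G.V) : Prop := ∀ e, G.s e ∈ H → G.r e ∈ H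

/-- A set of vertices is saturated if it contains every regular vertex all of whose
emitted edges have range in the set. -/
def Saturated (G : CKGraph) (H : Set G.V) : Prop :=
  ∀ v, G.Regular v → (∀ e, G.s e = v → G.r e ∈ H) → v ∈ H

/-- Move (S): removing the (regular) source `v` together with all edges it emits. -/
def removeSource (G : CKGraph) (v : G.V) (hsrc : G.IsSource v) : CKGraph where
  V := {w : G.V // w ≠ v}
  E := {e : G.E // G.s e ≠ v}
  r e := ⟨G.r e.1, hsrc e.1⟩
  s e := ⟨G.s e.1, e.2⟩

/-- Move (R): the reduction at a vertex `u` that emits exactly one edge `f` with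
`r f ≠ u` and receives only from the single vertex `v`. -/
def reduce (G : CKGraph) (u : G.V) (f : G.E) (hf : G.s f = u) (hrf : G.r f ≠ u)
    (honly : ∀ e, G.s e = u → e = f) (v : G.V) (hin : ∀ e, G.r e = u → G.s e = v) :
    CKGraph where
  V := {w : G.V // w ≠ u}
  E := {e : G.E // G.r e ≠ u ∧ e ≠ f} ⊕ {e : G.E // G.r e = u}
  r x :=
    match x with
    | .inl e => ⟨G.r e.1, e.2.1⟩
    | .inr _ => ⟨G.r f, hrf⟩
  s x :=
    match x with
    | .inl e => ⟨G.s e.1, fun h => e.2.2 (honly e.1 h)⟩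
    | .inr e => ⟨G.s e.1, by
        intro h
        have h2 : G.r e.1 = u := e.2
        rw [honly e.1 h] at h2
        exact hrf h2⟩

/-- Move (O): the out-split of `G` at `v` according to the partition of `s⁻¹(v)`
into the fibres of `P`. -/
noncomputable def outSplit (G : CKGraph) (v : G.V) (n : ℕ)
    (P : {e : G.E // G.s e = v} → Fin n) : CKGraph :=
  letI := Classical.decEq G.V
  { V := {w : G.V // w ≠ v} ⊕ Fin n
    E := {e : G.E // G.r e ≠ v} ⊕ ({e : G.E // G.r e = v} × Fin n)
    r := fun x =>
      match x with
      | .inl e => Sum.inl ⟨G.r e.1, e.2⟩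
      | .inr p => Sum.inr p.2
    s := fun x =>
      match x with
      | .inl e =>
          if h : G.s e.1 = v then Sum.inr (P ⟨e.1, h⟩) else Sum.inl ⟨G.s e.1, h⟩
      | .inr p =>
          if h : G.s p.1.1 = v then Sum.inr (P ⟨p.1.1, h⟩)
          else Sum.inl ⟨G.s p.1.1, h⟩ }

/-- Move (I): the in-split of `G` at `v` according to the partition of `r⁻¹(v)`
into the fibres of `P`. -/
noncomputable def inSplit (G : CKGraph) (v : G.V) (n : ℕ)
    (P : {e : G.E // G.r e = v} → Fin n) : CKGraph :=
  letI := Classical.decEq G.V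
  { V := {w : G.V // w ≠ v} ⊕ Fin n
    E := {e : G.E // G.s e ≠ v} ⊕ ({e : G.E // G.s e = v} × Fin n)
    s := fun x =>
      match x with
      | .inl e => Sum.inl ⟨G.s e.1, e.2⟩
      | .inr p => Sum.inr p.2
    r := fun x =>
      match x with
      | .inl e =>
          if h : G.r e.1 = v then Sum.inr (P ⟨e.1, h⟩) else Sum.inl ⟨G.r e.1, h⟩
      | .inr p =>
          if h : G.r p.1.1 = v then Sum.inr (P ⟨p.1.1, h⟩)
          else Sum.inl ⟨G.r p.1.1, h⟩ }

/-- Move-equivalence: the smallest equivalence relation on graphs with finitely many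
vertices such that `G ∼ H` whenever `H` is obtained from `G`, up to graph
isomorphism, by one of the moves (S), (I), (O), (R). -/
inductive MoveEquiv : CKGraph → CKGraph → Prop
  | of_iso {G H : CKGraph} (hG : Finite G.V) (h : Nonempty (Iso G H)) : MoveEquiv G H
  | moveS {G : CKGraph} (hG : Finite G.V) (v : G.V) (hreg : G.Regular v)
      (hsrc : G.IsSource v) {H : CKGraph}
      (h : Nonempty (Iso H (G.removeSource v hsrc))) : MoveEquiv G H
  | moveR {G : CKGraph} (hG : Finite G.V) (u : G.V) (f : G.E) (hf : G.s f = u)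
      (hrf : G.r f ≠ u) (honly : ∀ e, G.s e = u → e = f) (v : G.V)
      (hin : ∀ e, G.r e = u → G.s e = v) {H : CKGraph}
      (h : Nonempty (Iso H (G.reduce u f hf hrf honly v hin))) : MoveEquiv G H
  | moveO {G : CKGraph} (hG : Finite G.V) (v : G.V) (hns : ¬ G.IsSink v) (n : ℕ)
      (P : {e : G.E // G.s e = v} → Fin n) (hsurj : Function.Surjective P)
      (hinf : ∀ i j : Fin n, {x : {e : G.E // G.s e = v} | P x = i}.Infinite →
        {x : {e : G.E // G.s e = v} | P x = j}.Infinite → i = j)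
      {H : CKGraph} (h : Nonempty (Iso H (G.outSplit v n P))) : MoveEquiv G H
  | moveI {G : CKGraph} (hG : Finite G.V) (v : G.V) (hreg : G.Regular v)
      (hns : ¬ G.IsSource v) (n : ℕ) (P : {e : G.E // G.r e = v} → Fin n)
      (hsurj : Function.Surjective P) {H : CKGraph}
      (h : Nonempty (Iso H (G.inSplit v n P))) : MoveEquiv G H
  | symm {G H : CKGraph} : MoveEquiv G H → MoveEquiv H G
  | trans {G H K : CKGraph} : MoveEquiv G H → MoveEquiv H K → MoveEquiv G K

/-- The graph obtained from `G` by collapsing a regular non-source vertex `v` that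
emits exactly one edge `f₀`, which is not a loop: delete `v`, `f₀` and all edges into
`v`, and add an edge `[e f₀]` from `s e` to `r f₀` for every edge `e` into `v`. -/
def collapseOne (G : CKGraph) (v : G.V) (f₀ : G.E) (hf : G.s f₀ = v)
    (honly : ∀ e, G.s e = v → e = f₀) (hr : G.r f₀ ≠ v) : CKGraph where
  V := {w : G.V // w ≠ v}
  E := {e : G.E // G.r e ≠ v ∧ e ≠ f₀} ⊕ {e : G.E // G.r e = v}
  r x :=
    match x with
    | .inl e => ⟨G.r e.1, e.2.1⟩
    | .inr _ => ⟨G.r f₀, hr⟩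
  s x :=
    match x with
    | .inl e => ⟨G.s e.1, fun h => e.2.2 (honly e.1 h)⟩
    | .inr e => ⟨G.s e.1, by
        intro h
        have h2 : G.r e.1 = v := e.2
        rw [honly e.1 h] at h2
        exact hr h2⟩

/-- The graph obtained from `G` by collapsing a regular vertex `v` which does not
support a loop of length one: delete `v` and all edges into or out of `v`, and add
an edge `[e f]` from `s e` to `r f` for every pair of edges `e, f` with
`r e = v = s f`. -/
def collapse (G : CKGraph) (v : G.V) (hnl : ∀ e, G.s e = v → G.r e ≠ v) :
    CKGraph where
  V := {w : G.V // w ≠ v}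
  E := {e : G.E // G.r e ≠ v ∧ G.s e ≠ v} ⊕
    ({e : G.E // G.r e = v} × {f : G.E // G.s f = v})
  s x :=
    match x with
    | .inl e => ⟨G.s e.1, e.2.2⟩
    | .inr p => ⟨G.s p.1.1, fun h => hnl p.1.1 h p.1.2⟩
  r x :=
    match x with
    | .inl e => ⟨G.r e.1, e.2.1⟩
    | .inr p => ⟨G.r p.2.1, fun h => hnl p.2.1 p.2.2 h⟩

/-- The graph obtained from `G` by adding countably infinitely many new edges,
each with source `u` and range `w`. -/
def addEdges (G : CKGraph) (u w : G.V) : CKGraph where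
  V := G.V
  E := G.E ⊕ ℕ
  r x := match x with | .inl e => G.r e | .inr _ => w
  s x := match x with | .inl e => G.s e | .inr _ => u

/-- The graph with exactly one vertex and no edges. -/
def singletonGraph : CKGraph where
  V := PUnit
  E := Empty
  r e := e.elim
  s e := e.elim

/-- The Cuntz splice of `G` at `v`: add two new vertices `u₁, u₂` and six new edges:
`v → u₁`, `u₁ → v`, a loop at `u₁`, `u₁ → u₂`, `u₂ → u₁`, and a loop at `u₂`. -/
def cuntzSplice (G : CKGraph) (v : G.V) : CKGraph where
  V := G.V ⊕ Fin 2
  E := G.E ⊕ Fin 6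
  s x :=
    match x with
    | .inl e => Sum.inl (G.s e)
    | .inr i => ![Sum.inl v, Sum.inr 0, Sum.inr 0, Sum.inr 0, Sum.inr 1, Sum.inr 1] i
  r x :=
    match x with
    | .inl e => Sum.inl (G.r e)
    | .inr i => ![Sum.inr 0, Sum.inl v, Sum.inr 0, Sum.inr 1, Sum.inr 0, Sum.inr 1] i

/-- The adjacency matrix (as an integer matrix) of a graph whose vertices are
enumerated by `Fin n`. -/
noncomputable def adjMatrix (G : CKGraph) {n : ℕ} (ρ : G.V ≃ Fin n) :
    Matrix (Fin n) (Fin n) ℤ :=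
  Matrix.of fun i j => (Nat.card {e : G.E // G.s e = ρ.symm i ∧ G.r e = ρ.symm j} : ℤ)

end CKGraph

/-- The graph of an `ℕ∞`-valued square matrix: it has exactly `A x y` edges from
`x` to `y`. -/
def graphOfMatrix {n : ℕ} (A : Matrix (Fin n) (Fin n) ℕ∞) : CKGraph where
  V := Fin n
  E := Σ x : Fin n, Σ y : Fin n, {k : ℕ // (k : ℕ∞) < A x y}
  s e := e.1
  r e := e.2.1

/-- Move-equivalence of (possibly differently sized) square matrices over `ℕ∞`. -/
def MatMoveEquiv {m n : ℕ} (A : Matrix (Fin m) (Fin m) ℕ∞)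
    (B : Matrix (Fin n) (Fin n) ℕ∞) : Prop :=
  CKGraph.MoveEquiv (graphOfMatrix A) (graphOfMatrix B)

/-- A square matrix is irreducible if any index connects to any other index through
a chain of non-zero entries. -/
def MatIrreducible {n : ℕ} {α : Type*} [Zero α] (A : Matrix (Fin n) (Fin n) α) :
    Prop :=
  ∀ i j : Fin n, ∃ (l : ℕ) (c : ℕ → Fin n), 1 ≤ l ∧ c 0 = i ∧ c l = j ∧
    ∀ t < l, A (c t) (c (t + 1)) ≠ 0

/-- `Jmat n m` is the `n × n` matrix whose top-left `m × m` block is the identity,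
whose other entries in the first `m` rows are `0`, and whose last `n - m` rows have
every entry equal to `∞`. -/
def Jmat (n m : ℕ) : Matrix (Fin n) (Fin n) ℕ∞ :=
  Matrix.of fun i j => if i.1 < m then (if i = j then 1 else 0) else ⊤


/-! ### Graphs of natural number matrices and elementary moves -/

/-- The graph with vertex type `V` having `A x y` edges from `x` to `y`. -/
def matGraph {V : Type} (A : V → V → ℕ) : CKGraph where
  V := V
  E := Σ x : V, Σ y : V, Fin (A x y)
  s e := e.1
  r e := e.2.1

theorem matGraph_iso_of_fibers {V : Type} (A : V → V → ℕ) (G : CKGraph) (φ : V ≃ G.V)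
    (h : ∀ x y, ∃ f : Fin (A x y) → {e : G.E // G.s e = φ x ∧ G.r e = φ y},
      Function.Bijective f) :
    Nonempty (CKGraph.Iso (matGraph A) G) := by
  choose f hf using h
  refine ⟨⟨φ, Equiv.ofBijective
    (fun e : (Σ x : V, Σ y : V, Fin (A x y)) => (f e.1 e.2.1 e.2.2).1) ⟨?_, ?_⟩, ?_, ?_⟩⟩
  · rintro ⟨x, y, k⟩ ⟨x', y', k'⟩ hk
    have h1 := (f x y k).2
    have h2 := (f x' y' k').2
    dsimp only at hk
    rw [hk] at h1
    obtain rfl : x = x' := φ.injective (h1.1.symm.trans h2.1)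
    obtain rfl : y = y' := φ.injective (h1.2.symm.trans h2.2)
    obtain rfl : k = k' := (hf x y).1 (Subtype.ext hk)
    rfl
  · intro e
    obtain ⟨k, hk⟩ := (hf (φ.symm (G.s e)) (φ.symm (G.r e))).2 ⟨e, by simp, by simp⟩
    exact ⟨⟨_, _, k⟩, by simp [hk]⟩
  · rintro ⟨x, y, k⟩
    exact (f x y k).2.2
  · rintro ⟨x, y, k⟩
    exact (f x y k).2.1

/-- Vertices of the two-fold splitting of a graph at `v`. -/
noncomputable def splitVertexEquiv {V : Type} (v : V) : Option V ≃ {w : V // w ≠ v} ⊕ Fin 2 :=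
  letI := Classical.decEq V
  { toFun := fun x =>
      match x with
      | none => Sum.inr 0
      | some w => if h : w = v then Sum.inr 1 else Sum.inl ⟨w, h⟩
    invFun := Sum.elim (fun w => some w.1) (fun i => if i = 0 then none else some v)
    left_inv := by
      rintro (_ | w)
      · simp
      · by_cases h : w = v <;> simp [h]
    right_inv := by
      rintro (w | i)
      · simp [w.2]
      · fin_cases i <;> simp }

theorem splitVertexEquiv_self {V : Type} (v : V) : splitVertexEquiv v (some v) = Sum.inr 1 := by
  simp [splitVertexEquiv]

theorem splitVertexEquiv_of_ne {V : Type} (v : V) {w : V} (h : w ≠ v) :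
    splitVertexEquiv v (some w) = Sum.inl ⟨w, h⟩ := by
  simp [splitVertexEquiv, h]

open Classical in
/-- The matrix of the in-split at `v`, the new vertex `none` receiving `C x` of the edges
from `x` to `v`. -/
noncomputable def inMat {V : Type} (A : V → V → ℕ) (v : V) (C : V → ℕ) :
    Option V → Option V → ℕ := fun x y =>
  match y with
  | none => C (x.getD v)
  | some y => if y = v then A (x.getD v) v - C (x.getD v) else A (x.getD v) y

/-- The matrix of the out-split at `v`, the new vertex `none` emitting `C y` of the edges
from `v` to `y`. -/
noncomputable def outMat {V : Type} (A : V → V → ℕ) (v : V) (C : V → ℕ) :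
    Option V → Option V → ℕ := fun x y => inMat (fun a b => A b a) v C y x

namespace CKGraph

/-- The graph with all edges reversed. -/
def rev (G : CKGraph) : CKGraph where
  V := G.V
  E := G.E
  r := G.s
  s := G.r

/-- Isomorphic graphs have isomorphic reversals. -/
def Iso.rev {G H : CKGraph} (f : Iso G H) : Iso G.rev H.rev where
  vEquiv := f.vEquiv
  eEquiv := f.eEquiv
  map_r := f.map_s
  map_s := f.map_r

/-- Isomorphisms of graphs compose. -/
def Iso.trans {G H K : CKGraph} (f : Iso G H) (g : Iso H K) : Iso G K where
  vEquiv := f.vEquiv.trans g.vEquiv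
  eEquiv := f.eEquiv.trans g.eEquiv
  map_r e := by simp [g.map_r, f.map_r]
  map_s e := by simp [g.map_s, f.map_s]

/-- The isomorphism between the graph of the transpose and the reversed graph. -/
def revIso {V : Type} (A : V → V → ℕ) :
    Iso (matGraph fun x y => A y x) (matGraph A).rev where
  vEquiv := Equiv.refl V
  eEquiv :=
    { toFun := fun e : (Σ x : V, Σ y : V, Fin (A y x)) =>
        (⟨e.2.1, e.1, e.2.2⟩ : Σ x : V, Σ y : V, Fin (A x y))
      invFun := fun e : (Σ x : V, Σ y : V, Fin (A x y)) =>
        (⟨e.2.1, e.1, e.2.2⟩ : Σ x : V, Σ y : V, Fin (A y x))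
      left_inv := fun _ => rfl
      right_inv := fun _ => rfl }
  map_r _ := rfl
  map_s _ := rfl

open Classical in
/-- The range in an in-split graph of the copies of an edge. -/
noncomputable def splitRange (G : CKGraph) (v : G.V) {n : ℕ}
    (P : {e : G.E // G.r e = v} → Fin n) (e : G.E) : {w : G.V // w ≠ v} ⊕ Fin n :=
  if h : G.r e = v then Sum.inr (P ⟨e, h⟩) else Sum.inl ⟨G.r e, h⟩

theorem inSplit_fiber (G : CKGraph) (v : G.V) {n : ℕ} (P : {e : G.E // G.r e = v} → Fin n)
    (w t : {w : G.V // w ≠ v} ⊕ Fin n) :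
    ∃ f : {e : G.E // G.s e = Sum.elim Subtype.val (fun _ => v) w ∧ G.splitRange v P e = t} →
      {z : (G.inSplit v n P).E // (G.inSplit v n P).s z = w ∧ (G.inSplit v n P).r z = t},
      Function.Bijective f := by
  rcases w with w | i
  · refine ⟨fun e => ⟨Sum.inl ⟨e.1, e.2.1.trans_ne w.2⟩, ?_, ?_⟩, ?_, ?_⟩
    · exact congrArg Sum.inl (Subtype.ext e.2.1)
    · exact e.2.2
    · intro e e' h
      exact Subtype.ext (congrArg (fun p : {e : G.E // G.s e ≠ v} => p.1)
        (Sum.inl_injective (congrArg Subtype.val h)))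
    · rintro ⟨e | p, h1, h2⟩
      · have h1' := Sum.inl_injective h1
        exact ⟨⟨e.1, congrArg Subtype.val h1', h2⟩, rfl⟩
      · cases h1
  · refine ⟨fun e => ⟨Sum.inr (⟨e.1, e.2.1⟩, i), ?_, ?_⟩, ?_, ?_⟩
    · rfl
    · exact e.2.2
    · intro e e' h
      exact Subtype.ext (congrArg (fun p : {e : G.E // G.s e = v} × Fin n => p.1.1)
        (Sum.inr_injective (congrArg Subtype.val h)))
    · rintro ⟨e | p, h1, h2⟩
      · cases h1
      · obtain ⟨p, j⟩ := p
        obtain rfl : j = i := Sum.inr_injective h1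
        exact ⟨⟨p.1, p.2, h2⟩, rfl⟩

theorem elim_splitVertexEquiv {V : Type} (v : V) (x : Option V) :
    Sum.elim Subtype.val (fun _ => v) (splitVertexEquiv v x) = x.getD v := by
  rcases x with _ | w
  · rfl
  · by_cases h : w = v
    · subst h; simp [splitVertexEquiv_self]
    · simp [splitVertexEquiv_of_ne v h]

theorem inSplit_iso (G : CKGraph) (v : G.V) (P : {e : G.E // G.r e = v} → Fin 2)
    (M : Option G.V → Option G.V → ℕ) (tgt : G.E → Option G.V)
    (ht : ∀ e, G.splitRange v P e = splitVertexEquiv v (tgt e))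
    (h : ∀ x y, ∃ f : Fin (M x y) → {e : G.E // G.s e = x.getD v ∧ tgt e = y},
      Function.Bijective f) :
    Nonempty (Iso (matGraph M) (G.inSplit v 2 P)) := by
  refine matGraph_iso_of_fibers _ _ (splitVertexEquiv v) fun x y => ?_
  obtain ⟨f, hf⟩ := h x y
  have hg := G.inSplit_fiber v P (splitVertexEquiv v x) (splitVertexEquiv v y)
  rw [elim_splitVertexEquiv] at hg
  obtain ⟨g, hg⟩ := hg
  let q : {e : G.E // G.s e = x.getD v ∧ tgt e = y} ≃
      {e : G.E // G.s e = x.getD v ∧ G.splitRange v P e = splitVertexEquiv v y} :=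
    Equiv.subtypeEquivRight fun e =>
      and_congr_right' (by rw [ht]; exact (splitVertexEquiv v).apply_eq_iff_eq.symm)
  exact ⟨g ∘ q ∘ f, hg.comp (q.bijective.comp hf)⟩

theorem outSplit_iso (G : CKGraph) (v : G.V) (P : {e : G.E // G.s e = v} → Fin 2)
    (M : Option G.V → Option G.V → ℕ) (tgt : G.E → Option G.V)
    (ht : ∀ e, G.rev.splitRange v P e = splitVertexEquiv v (tgt e))
    (h : ∀ x y, ∃ f : Fin (M y x) → {e : G.E // G.r e = x.getD v ∧ tgt e = y},
      Function.Bijective f) :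
    Nonempty (Iso (matGraph M) (G.outSplit v 2 P)) := by
  obtain ⟨f⟩ := inSplit_iso G.rev v P (fun x y => M y x) tgt ht h
  exact ⟨((revIso fun x y => M y x).trans f.rev).trans
    ⟨Equiv.refl _, Equiv.refl _, by rintro (e | p) <;> rfl, by rintro (e | p) <;> rfl⟩⟩

/-- The partition of the edges into `v` of the graph of a matrix into the first `C x` edges
from each `x` and the remaining ones. -/
def inPart {V : Type} (A : V → V → ℕ) (v : V) (C : V → ℕ) :
    {e : (matGraph A).E // (matGraph A).r e = v} → Fin 2 :=
  fun e => if (e.1.2.2 : ℕ) < C e.1.1 then 0 else 1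

/-- The partition of the edges out of `v` of the graph of a matrix into the first `C y` edges
to each `y` and the remaining ones. -/
def outPart {V : Type} (A : V → V → ℕ) (v : V) (C : V → ℕ) :
    {e : (matGraph A).E // (matGraph A).s e = v} → Fin 2 :=
  fun e => if (e.1.2.2 : ℕ) < C e.1.2.1 then 0 else 1

open Classical in
/-- The range of an edge after the in-split at `v`. -/
noncomputable def inTgt {V : Type} (A : V → V → ℕ) (v : V) (C : V → ℕ)
    (e : Σ x : V, Σ y : V, Fin (A x y)) : Option V :=
  if e.2.1 = v then if (e.2.2 : ℕ) < C e.1 then none else some v else some e.2.1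

theorem inMat_fiber {V : Type} (A : V → V → ℕ) (v : V) (C : V → ℕ) (hC : ∀ x, C x ≤ A x v)
    (x y : Option V) : ∃ f : Fin (inMat A v C x y) →
      {e : (Σ x : V, Σ y : V, Fin (A x y)) // e.1 = x.getD v ∧ inTgt A v C e = y},
      Function.Bijective f := by
  rcases y with _ | y
  · refine ⟨fun k => ⟨⟨x.getD v, v, ⟨k, k.2.trans_le (hC _)⟩⟩, rfl, ?_⟩, ?_, ?_⟩
    · have : (k : ℕ) < C (x.getD v) := k.2
      simp [inTgt, this]
    · intro k k' h
      have := congrArg (fun e => (e.1.2.2 : ℕ)) h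
      exact Fin.ext this
    · rintro ⟨⟨a, b, k⟩, h1, h2⟩
      obtain rfl : a = x.getD v := h1
      by_cases hb : b = v
      · subst hb
        by_cases hk : (k : ℕ) < C (x.getD b)
        · exact ⟨⟨k, hk⟩, rfl⟩
        · simp [inTgt, hk] at h2
      · simp [inTgt, hb] at h2
  · by_cases hy : y = v
    · subst hy
      have hM : inMat A y C x (some y) = A (x.getD y) y - C (x.getD y) := by simp [inMat]
      rw [hM]
      refine ⟨fun k => ⟨⟨x.getD y, y, ⟨C (x.getD y) + k, by omega⟩⟩, rfl, ?_⟩, ?_, ?_⟩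
      · simp [inTgt]
      · intro k k' h
        have := congrArg (fun e => (e.1.2.2 : ℕ)) h
        simp at this
        exact Fin.ext this
      · rintro ⟨⟨a, b, k⟩, h1, h2⟩
        obtain rfl : a = x.getD y := h1
        by_cases hb : b = y
        · subst hb
          by_cases hk : (k : ℕ) < C (x.getD b)
          · simp [inTgt, hk] at h2
          · refine ⟨⟨k - C (x.getD b), by omega⟩, ?_⟩
            have : (⟨C (x.getD b) + (k - C (x.getD b)), by omega⟩ : Fin (A (x.getD b) b)) = k :=
              Fin.ext (by simp; omega)
            simp [this]
        · simp [inTgt, hb] at h2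
    · have hM : inMat A v C x (some y) = A (x.getD v) y := by simp [inMat, hy]
      rw [hM]
      refine ⟨fun k => ⟨⟨x.getD v, y, k⟩, rfl, ?_⟩, ?_, ?_⟩
      · simp [inTgt, hy]
      · intro k k' h
        have := congrArg (fun e => (e.1.2.2 : ℕ)) h
        exact Fin.ext this
      · rintro ⟨⟨a, b, k⟩, h1, h2⟩
        obtain rfl : a = x.getD v := h1
        by_cases hb : b = v
        · subst hb
          simp only [inTgt, if_true] at h2
          split_ifs at h2
          exact absurd (Option.some.inj h2).symm hy
        · simp [inTgt, hb] at h2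
          subst h2
          exact ⟨k, rfl⟩

theorem inMat_iso {V : Type} (A : V → V → ℕ) (v : V) (C : V → ℕ) (hC : ∀ x, C x ≤ A x v) :
    Nonempty (Iso (matGraph (inMat A v C)) ((matGraph A).inSplit v 2 (inPart A v C))) := by
  refine inSplit_iso (matGraph A) v (inPart A v C) (inMat A v C) (inTgt A v C) ?_
    (inMat_fiber A v C hC)
  rintro ⟨a, b, k⟩
  by_cases hb : b = v
  · subst hb
    by_cases hk : (k : ℕ) < C a
    · simp [splitRange, matGraph, inTgt, inPart, hk]
      rfl
    · simp [splitRange, matGraph, inTgt, inPart, hk]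
      exact (splitVertexEquiv_self b).symm
  · simp [splitRange, matGraph, inTgt, hb]
    exact (splitVertexEquiv_of_ne v hb).symm

theorem outMat_iso {V : Type} (A : V → V → ℕ) (v : V) (C : V → ℕ) (hC : ∀ y, C y ≤ A v y) :
    Nonempty (Iso (matGraph (outMat A v C)) ((matGraph A).outSplit v 2 (outPart A v C))) := by
  refine outSplit_iso (matGraph A) v (outPart A v C) (outMat A v C)
    (fun e => inTgt (fun x y => A y x) v C ((revIso A).eEquiv.symm e)) ?_ ?_
  · rintro ⟨a, b, k⟩
    change _ = splitVertexEquiv v (inTgt (fun x y => A y x) v C ⟨b, a, k⟩)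
    by_cases hb : a = v
    · subst hb
      by_cases hk : (k : ℕ) < C b
      · simp [splitRange, matGraph, rev, inTgt, outPart, hk]
        rfl
      · simp [splitRange, matGraph, rev, inTgt, outPart, hk]
        exact (splitVertexEquiv_self a).symm
    · simp [splitRange, matGraph, rev, inTgt, hb]
      exact (splitVertexEquiv_of_ne v hb).symm
  · intro x y
    obtain ⟨f, hf⟩ := inMat_fiber (fun x y => A y x) v C hC x y
    refine ⟨fun k => ⟨(revIso A).eEquiv (f k).1, (f k).2.1, ?_⟩, ?_, ?_⟩
    · exact (congrArg (inTgt (fun x y => A y x) v C)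
        ((revIso A).eEquiv.symm_apply_apply _)).trans (f k).2.2
    · intro k k' h
      exact hf.1 (Subtype.ext ((revIso A).eEquiv.injective (congrArg Subtype.val h)))
    · rintro ⟨e, h1, h2⟩
      obtain ⟨k, hk⟩ := hf.2 ⟨(revIso A).eEquiv.symm e, h1, h2⟩
      exact ⟨k, Subtype.ext ((congrArg (fun z => (revIso A).eEquiv z.1) hk).trans
        ((revIso A).eEquiv.apply_symm_apply e))⟩

end CKGraph

open Classical in
/-- Move equivalence of matrices generated by reindexing, two-fold in-splits and out-splits, and
reductions. -/
inductive MatMove : (V : Type) → (V → V → ℕ) → (W : Type) → (W → W → ℕ) → Prop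
  | reindex {V W : Type} [Finite V] (A : V → V → ℕ) (φ : W ≃ V) :
      MatMove V A W (fun x y => A (φ x) (φ y))
  | ins {V : Type} [Finite V] (A : V → V → ℕ) (v : V) (C : V → ℕ) (hC : ∀ x, C x ≤ A x v)
      (h0 : ∃ x, 0 < C x) (h1 : ∃ x, C x < A x v) (h2 : ∃ y, 0 < A v y) :
      MatMove V A (Option V) (inMat A v C)
  | outs {V : Type} [Finite V] (A : V → V → ℕ) (v : V) (C : V → ℕ) (hC : ∀ y, C y ≤ A v y)
      (h0 : ∃ y, 0 < C y) (h1 : ∃ y, C y < A v y) (h2 : ∃ x, 0 < A x v) :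
      MatMove V A (Option V) (outMat A v C)
  | red {V : Type} [Finite V] (A : Option V → Option V → ℕ) (i j : V) (h0 : A none none = 0)
      (h1 : ∀ y, A none (some y) = if y = j then 1 else 0)
      (h2 : ∀ x, A (some x) none = if x = i then 1 else 0) :
      MatMove (Option V) A V (fun x y => A (some x) (some y) + if x = i ∧ y = j then 1 else 0)
  | symm {V W : Type} {A : V → V → ℕ} {B : W → W → ℕ} : MatMove V A W B → MatMove W B V A
  | trans {V W X : Type} {A : V → V → ℕ} {B : W → W → ℕ} {C : X → X → ℕ} :
      MatMove V A W B → MatMove W B X C → MatMove V A X C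

namespace MatMove

theorem refl {V : Type} [Finite V] (A : V → V → ℕ) : MatMove V A V A :=
  reindex A (Equiv.refl V)

theorem transpose {V W : Type} {A : V → V → ℕ} {B : W → W → ℕ} (h : MatMove V A W B) :
    MatMove V (fun x y => A y x) W (fun x y => B y x) := by
  induction h with
  | reindex A φ => exact reindex (fun x y => A y x) φ
  | ins A v C hC h0 h1 h2 => exact outs (fun x y => A y x) v C hC h0 h1 h2
  | outs A v C hC h0 h1 h2 => exact ins (fun x y => A y x) v C hC h0 h1 h2
  | red A i j h0 h1 h2 =>
    convert red (fun x y => A y x) j i h0 h2 h1 using 5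
    exact and_comm
  | symm _ ih => exact ih.symm
  | trans _ _ ih1 ih2 => exact ih1.trans ih2

end MatMove

instance {V : Type} [h : Finite V] (A : V → V → ℕ) : Finite (matGraph A).V := h

instance {V : Type} [Finite V] (A : V → V → ℕ) : Finite (matGraph A).E :=
  inferInstanceAs (Finite (Σ x : V, Σ y : V, Fin (A x y)))

theorem moveEquiv_red {V : Type} [Finite V] [DecidableEq V] (A : Option V → Option V → ℕ)
    (i j : V) (h0 : A none none = 0) (h1 : ∀ y, A none (some y) = if y = j then 1 else 0)
    (h2 : ∀ x, A (some x) none = if x = i then 1 else 0) :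
    CKGraph.MoveEquiv (matGraph A)
      (matGraph fun x y => A (some x) (some y) + if x = i ∧ y = j then 1 else 0) := by
  have hout : ∀ e : (Σ x, Σ y, Fin (A x y)), e.1 = none →
      e = ⟨none, some j, ⟨0, by simp [h1]⟩⟩ := by
    rintro ⟨a, b, k⟩ ha
    obtain rfl : a = none := ha
    rcases b with _ | b
    · have := k.2
      omega
    · have hk := k.2
      have hb := h1 b
      split_ifs at hb with hbj
      · subst hbj
        have : k = ⟨0, by omega⟩ := Fin.ext (by simp; omega)
        rw [this]
      · omega
  have hin : ∀ e : (Σ x, Σ y, Fin (A x y)), e.2.1 = none →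
      e = ⟨some i, none, ⟨0, by simp [h2]⟩⟩ := by
    rintro ⟨a, b, k⟩ hb
    obtain rfl : b = none := hb
    rcases a with _ | a
    · have := k.2
      omega
    · have hk := k.2
      have ha := h2 a
      split_ifs at ha with hai
      · subst hai
        have : k = ⟨0, by omega⟩ := Fin.ext (by simp; omega)
        rw [this]
      · omega
  refine .moveR inferInstance (none : Option V)
    (⟨none, some j, ⟨0, by simp [h1]⟩⟩ : Σ x, Σ y, Fin (A x y)) rfl
    (Option.some_ne_none j) hout (some i) (fun e he => congrArg Sigma.fst (hin e he)) ?_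
  refine matGraph_iso_of_fibers _ _ (Equiv.ofBijective
    (fun x : V => (⟨some x, Option.some_ne_none x⟩ : {w : Option V // w ≠ none}))
    ⟨fun x y h => Option.some_injective V (congrArg Subtype.val h), ?_⟩) fun x y => ?_
  · rintro ⟨_ | w, hw⟩
    · exact absurd rfl hw
    · exact ⟨w, rfl⟩
  · by_cases hxy : x = i ∧ y = j
    · obtain ⟨rfl, rfl⟩ := hxy
      rw [if_pos ⟨rfl, rfl⟩]
      refine ⟨fun k => if hk : (k : ℕ) < A (some x) (some y) then
          ⟨Sum.inl ⟨⟨some x, some y, ⟨k, hk⟩⟩, Option.some_ne_none y,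
            fun h => Option.some_ne_none x (congrArg Sigma.fst h)⟩, rfl, rfl⟩
        else ⟨Sum.inr ⟨⟨some x, none, ⟨0, by simp [h2]⟩⟩, rfl⟩, rfl, rfl⟩, ?_, ?_⟩
      · intro k k' h
        by_cases hk : (k : ℕ) < A (some x) (some y) <;>
          by_cases hk' : (k' : ℕ) < A (some x) (some y)
        · simp only [dif_pos hk, dif_pos hk'] at h
          have := congrArg (fun e : (Σ x, Σ y, Fin (A x y)) => (e.2.2 : ℕ))
            (congrArg Subtype.val (Sum.inl_injective (congrArg Subtype.val h)))
          exact Fin.ext this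
        · simp only [dif_pos hk, dif_neg hk'] at h
          exact absurd (congrArg Subtype.val h) Sum.inl_ne_inr
        · simp only [dif_neg hk, dif_pos hk'] at h
          exact absurd (congrArg Subtype.val h) Sum.inr_ne_inl
        · exact Fin.ext (by omega)
      · rintro ⟨⟨⟨a, b, k⟩, h3, h4⟩ | ⟨e, he⟩, h5, h6⟩
        · obtain rfl : a = some x := congrArg Subtype.val h5
          obtain rfl : b = some y := congrArg Subtype.val h6
          refine ⟨⟨k, by omega⟩, ?_⟩
          simp
        · refine ⟨⟨A (some x) (some y), by omega⟩, ?_⟩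
          simp [hin e he]
    · rw [if_neg hxy]
      refine ⟨fun k => ⟨Sum.inl ⟨⟨some x, some y, k⟩, Option.some_ne_none y,
            fun h => Option.some_ne_none x (congrArg Sigma.fst h)⟩, rfl, rfl⟩, ?_, ?_⟩
      · intro k k' h
        have := congrArg (fun e : (Σ x, Σ y, Fin (A x y)) => (e.2.2 : ℕ))
            (congrArg Subtype.val (Sum.inl_injective (congrArg Subtype.val h)))
        exact Fin.ext this
      · rintro ⟨⟨⟨a, b, k⟩, h3, h4⟩ | ⟨e, he⟩, h5, h6⟩
        · obtain rfl : a = some x := congrArg Subtype.val h5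
          obtain rfl : b = some y := congrArg Subtype.val h6
          exact ⟨k, rfl⟩
        · refine absurd ⟨?_, ?_⟩ hxy
          · have : e.1 = some x := congrArg Subtype.val h5
            rw [hin e he] at this
            exact (Option.some_injective V this).symm
          · exact (Option.some_injective V (congrArg Subtype.val h6)).symm

theorem MatMove.moveEquiv {V W : Type} {A : V → V → ℕ} {B : W → W → ℕ}
    (h : MatMove V A W B) : CKGraph.MoveEquiv (matGraph A) (matGraph B) := by
  classical
  induction h with
  | reindex A φ =>
    refine .symm (.of_iso (Finite.of_equiv _ φ.symm) (matGraph_iso_of_fibers _ _ φ fun x y => ?_))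
    exact ⟨fun k => ⟨⟨φ x, φ y, k⟩, rfl, rfl⟩,
      fun k k' h => Fin.ext (congrArg (fun e : (Σ x, Σ y, Fin (A x y)) => (e.2.2 : ℕ))
        (congrArg Subtype.val h)), by
      rintro ⟨⟨a, b, k⟩, h1, h2⟩
      obtain rfl : a = φ x := h1
      obtain rfl : b = φ y := h2
      exact ⟨k, rfl⟩⟩
  | ins A v C hC h0 h1 h2 =>
    obtain ⟨x, hx⟩ := h0
    obtain ⟨y, hy⟩ := h1
    obtain ⟨z, hz⟩ := h2
    refine .moveI inferInstance v ⟨⟨(⟨v, z, ⟨0, hz⟩⟩ : Σ x, Σ y, Fin (A x y)), rfl⟩,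
      Set.toFinite _⟩ (fun h => h (⟨y, v, ⟨C y, hy⟩⟩ : Σ x, Σ y, Fin (A x y)) rfl) 2
      (CKGraph.inPart A v C) ?_ (CKGraph.inMat_iso A v C hC)
    intro i
    fin_cases i
    · exact ⟨⟨(⟨x, v, ⟨0, hx.trans_le (hC x)⟩⟩ : Σ x, Σ y, Fin (A x y)), rfl⟩,
        by simp [CKGraph.inPart, hx]⟩
    · exact ⟨⟨(⟨y, v, ⟨C y, hy⟩⟩ : Σ x, Σ y, Fin (A x y)), rfl⟩,
        by simp [CKGraph.inPart]⟩
  | outs A v C hC h0 h1 h2 =>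
    obtain ⟨x, hx⟩ := h0
    obtain ⟨y, hy⟩ := h1
    refine .moveO inferInstance v
      (fun h => h (⟨v, y, ⟨C y, hy⟩⟩ : Σ x, Σ y, Fin (A x y)) rfl) 2
      (CKGraph.outPart A v C) ?_ (fun i j h => absurd (Set.toFinite _) h)
      (CKGraph.outMat_iso A v C hC)
    intro i
    fin_cases i
    · exact ⟨⟨(⟨v, x, ⟨0, hx.trans_le (hC x)⟩⟩ : Σ x, Σ y, Fin (A x y)), rfl⟩,
        by simp [CKGraph.outPart, hx]⟩
    · exact ⟨⟨(⟨v, y, ⟨C y, hy⟩⟩ : Σ x, Σ y, Fin (A x y)), rfl⟩,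
        by simp [CKGraph.outPart]⟩
  | red A i j h0 h1 h2 =>
    exact moveEquiv_red A i j h0 (fun y => by rw [h1]) (fun y => by rw [h2])
  | symm _ ih => exact ih.symm
  | trans _ _ ih1 ih2 => exact ih1.trans ih2

namespace MatMove

open Classical in
/-- A vertex without loops which receives a single edge, coming from `i`, may be removed, letting
`i` emit the edges it emitted. -/
theorem slide {W : Type} [Fintype W] (i : W) (A : Option W → Option W → ℕ)
    (h0 : A none none = 0) (h2 : ∀ x, A (some x) none = if x = i then 1 else 0)
    (hR : ∃ y, 0 < A none (some y)) :
    MatMove (Option W) A W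
      (fun x y => A (some x) (some y) + if x = i then A none (some y) else 0) := by
  induction hN : ∑ y, A none (some y) using Nat.strong_induction_on generalizing A with
  | _ N ih =>
  obtain ⟨j, hj⟩ := hR
  by_cases h1 : ∀ y, A none (some y) = if y = j then 1 else 0
  · convert red A i j h0 h1 h2 using 4 with x y
    rw [h1]
    by_cases hx : x = i <;> simp [hx]
  · have hC : ∃ y, (if y = some j then 1 else 0) < A none y := by
      push Not at h1
      obtain ⟨y, hy⟩ := h1
      refine ⟨some y, ?_⟩
      by_cases hyj : y = j
      · subst hyj
        simp only [if_true] at hy ⊢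
        omega
      · simp only [Option.some_inj, hyj, if_false] at hy ⊢
        omega
    have s1 := outs A none (fun y => if y = some j then 1 else 0) (fun y => by
      split_ifs with h
      · subst h; omega
      · omega) ⟨some j, by simp⟩ hC ⟨some i, by simp [h2]⟩
    have s2 := red (outMat A none (fun y => if y = some j then 1 else 0)) (some i) (some j)
      (by simp [outMat, inMat]) (by simp [outMat, inMat]) (by
        rintro (_ | x)
        · simp [outMat, inMat, h0]
        · simp [outMat, inMat, h2])
    have s3 := s1.trans s2
    refine s3.trans ?_
    have s4 := ih (∑ y, (A none (some y) - if y = j then 1 else 0)) (by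
        rw [← hN]
        refine Finset.sum_lt_sum (fun y _ => Nat.sub_le _ _) ⟨j, Finset.mem_univ _, ?_⟩
        simp only [if_true]
        omega)
      (fun x y => outMat A none (fun y => if y = some j then 1 else 0) (some x) (some y) +
        if x = some i ∧ y = some j then 1 else 0) (by simp [outMat, inMat, h0])
      (by simp [outMat, inMat, h2]) (by
        obtain ⟨_ | y, hy⟩ := hC
        · simp [h0] at hy
        · refine ⟨y, ?_⟩
          simpa [outMat, inMat] using hy) (by simp [outMat, inMat])
    convert s4 using 1
    · congr!
    funext x y
    by_cases hx : x = i
    · subst hx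
      by_cases hy : y = j
      · subst hy
        simp [outMat, inMat]
        omega
      · simp [outMat, inMat, hy]
    · simp [outMat, inMat, hx]

open Classical in
/-- If there is an edge from `i` to `j ≠ i` and a loop at `j`, one edge from `i` to `j` may be
replaced by the edges emitted by `j`. -/
theorem addRow {V : Type} [Fintype V] (A : V → V → ℕ) {i j : V} (hij : i ≠ j) (h1 : 0 < A i j)
    (h2 : 0 < A j j) :
    MatMove V A V (fun x y => if x = i then A i y + A j y - (if y = j then 1 else 0)
      else A x y) := by
  have s1 := ins A j (fun x => if x = i then 1 else 0) (fun x => by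
    split_ifs with h
    · subst h; omega
    · omega) ⟨i, by simp⟩ ⟨j, by simpa [hij.symm] using h2⟩ ⟨j, h2⟩
  refine s1.trans ?_
  have s2 := slide i (inMat A j (fun x => if x = i then 1 else 0))
    (by simp [inMat, hij.symm]) (by simp [inMat])
    ⟨j, by simpa [inMat, hij.symm] using h2⟩
  convert s2 using 3 with x y
  by_cases hx : x = i
  · subst hx
    by_cases hy : y = j
    · subst hy
      simp [inMat, hij.symm]
      omega
    · simp [inMat, hy]
  · simp only [hx, if_false]
    by_cases hy : y = j
    · subst hy
      simp [inMat, hx]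
    · simp [inMat, hy]

open Classical in
/-- If there is an edge from `i` to `j ≠ i` and a loop at `i`, one edge from `i` to `j` may be
replaced by the edges received by `i`. -/
theorem addCol {V : Type} [Fintype V] (A : V → V → ℕ) {i j : V} (hij : i ≠ j) (h1 : 0 < A i j)
    (h2 : 0 < A i i) :
    MatMove V A V (fun x y => if y = j then A x j + A x i - (if x = i then 1 else 0)
      else A x y) :=
  (addRow (fun x y => A y x) hij.symm h1 h2).transpose

end MatMove

/-- Two integer matrices are related if the graphs with adjacency matrices `1 + M` and `1 + N`
are move equivalent. -/
def MatRel {V W : Type} [DecidableEq V] [DecidableEq W] (M : Matrix V V ℤ) (N : Matrix W W ℤ) :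
    Prop :=
  MatMove V (fun x y => ((1 + M) x y).toNat) W (fun x y => ((1 + N) x y).toNat)

namespace MatRel

theorem symm {V W : Type} [DecidableEq V] [DecidableEq W] {M : Matrix V V ℤ} {N : Matrix W W ℤ}
    (h : MatRel M N) : MatRel N M := MatMove.symm h

theorem trans {V W X : Type} [DecidableEq V] [DecidableEq W] [DecidableEq X]
    {M : Matrix V V ℤ} {N : Matrix W W ℤ} {K : Matrix X X ℤ}
    (h : MatRel M N) (h' : MatRel N K) : MatRel M K := MatMove.trans h h'

theorem refl {V : Type} [Finite V] [DecidableEq V] (M : Matrix V V ℤ) : MatRel M M :=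
  MatMove.refl _

theorem transpose {V W : Type} [DecidableEq V] [DecidableEq W] {M : Matrix V V ℤ}
    {N : Matrix W W ℤ} (h : MatRel M N) : MatRel M.transpose N.transpose := by
  have := MatMove.transpose h
  simpa [MatRel, Matrix.one_apply, eq_comm] using this

theorem submatrix {V W : Type} [Finite V] [DecidableEq V] [DecidableEq W] (M : Matrix V V ℤ)
    (e : W ≃ V) : MatRel M (M.submatrix e e) := by
  have := MatMove.reindex (fun x y => ((1 + M) x y).toNat) e
  simpa [MatRel, Matrix.one_apply] using this

theorem addRow {V : Type} [Fintype V] [DecidableEq V] (M : Matrix V V ℤ) {i j : V} (hij : i ≠ j)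
    (h0 : ∀ x y, 0 ≤ (1 + M) x y) (h1 : 1 ≤ M i j) (h2 : 0 ≤ M j j) :
    MatRel M (M.updateRow i (M i + M j)) := by
  have := MatMove.addRow (fun x y => ((1 + M) x y).toNat) hij
    (by simp [hij]; omega) (by simp; omega)
  unfold MatRel
  convert this using 3 with x y
  have hx := h0 x y
  have hi := h0 i y
  have hj := h0 j y
  simp only [Matrix.add_apply, Matrix.one_apply, Matrix.updateRow_apply, Pi.add_apply] at *
  grind

theorem addCol {V : Type} [Fintype V] [DecidableEq V] (M : Matrix V V ℤ) {i j : V} (hij : i ≠ j)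
    (h0 : ∀ x y, 0 ≤ (1 + M) x y) (h1 : 1 ≤ M i j) (h2 : 0 ≤ M i i) :
    MatRel M (M.updateCol j (fun x => M x j + M x i)) := by
  have := (addRow M.transpose hij.symm (fun x y => by
    simpa [Matrix.one_apply, eq_comm] using h0 y x) h1 h2).transpose
  rw [← Matrix.updateCol_transpose] at this
  exact this

end MatRel

namespace MatRel

open Matrix

theorem row_transvection {V : Type} [Fintype V] [DecidableEq V] (M : Matrix V V ℤ) {i j : V}
    (hij : i ≠ j) (h0 : ∀ x y, 0 ≤ (1 + M) x y) (h1 : 1 ≤ M i j) (h2 : 0 ≤ M j j) (t : ℕ) :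
    MatRel M (transvection i j (t : ℤ) * M) := by
  have hj : ∀ y, 0 ≤ M j y := fun y => by
    by_cases hy : y = j
    · exact hy ▸ h2
    · simpa [Matrix.one_apply, Ne.symm hy] using h0 j y
  induction t with
  | zero => simpa using refl M
  | succ t ih =>
    have h := addRow (transvection i j (t : ℤ) * M) hij (fun x y => by
      by_cases hx : x = i
      · subst hx
        have := h0 x y
        have := mul_nonneg (Int.natCast_nonneg t) (hj y)
        simp only [Matrix.add_apply, transvection_mul_apply_same] at *
        omega
      · simpa [hx] using h0 x y) (by
        have := mul_nonneg (Int.natCast_nonneg t) h2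
        simp only [transvection_mul_apply_same]
        omega) (by simpa [hij.symm] using h2)
    convert ih.trans h using 1
    ext x y
    by_cases hx : x = i
    · subst hx
      simp [hij.symm]
      ring
    · simp [hx]

theorem col_transvection {V : Type} [Fintype V] [DecidableEq V] (M : Matrix V V ℤ) {i j : V}
    (hij : i ≠ j) (h0 : ∀ x y, 0 ≤ (1 + M) x y) (h1 : 1 ≤ M i j) (h2 : 0 ≤ M i i) (t : ℕ) :
    MatRel M (M * transvection i j (t : ℤ)) := by
  have := (row_transvection M.transpose hij.symm (fun x y => by
    simpa [Matrix.one_apply, eq_comm] using h0 y x) h1 h2 t).transpose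
  have e : M * transvection i j (t : ℤ) = (transvection j i (t : ℤ) * M.transpose).transpose := by
    ext x y
    by_cases hy : y = j
    · subst hy
      simp
    · simp [hy]
  rw [e]
  exact this

end MatRel

section Bordered

open Matrix

variable {ι : Type} [Fintype ι] [DecidableEq ι]

/-- The matrix obtained from `1 ⊕ X` by adding `w y` times the first column to column `y` and then
`u x` times the first row to row `x`. -/
def bordered (u w : ι → ℤ) (X : Matrix ι ι ℤ) : Matrix (Option ι) (Option ι) ℤ :=
  Matrix.of fun r c => match r, c with
    | none, none => 1
    | none, some y => w y
    | some x, none => u x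
    | some x, some y => u x * w y + X x y

/-- Two matrices are related if they become so after exchanging the rows `none` and `some o`. -/
def SwapRel (o : ι) (Y Z : Matrix (Option ι) (Option ι) ℤ) : Prop :=
  MatRel (Y.submatrix (Equiv.swap none (some o)) id) (Z.submatrix (Equiv.swap none (some o)) id)

theorem SwapRel.row {o : ι} (Y : Matrix (Option ι) (Option ι) ℤ) {i j : Option ι} (hij : i ≠ j)
    (h0 : ∀ x y, 0 ≤ Y x y) (h1 : 1 ≤ Y i (Equiv.swap none (some o) j)) (t : ℕ) :
    SwapRel o Y (transvection i j (t : ℤ) * Y) := by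
  have := MatRel.row_transvection (Y.submatrix (Equiv.swap none (some o)) id)
    (i := Equiv.swap none (some o) i) (j := Equiv.swap none (some o) j)
    (by simpa using hij) (fun x y => by
      have := h0 (Equiv.swap none (some o) x) y
      simp only [Matrix.add_apply, Matrix.one_apply, Matrix.submatrix_apply, id]
      split_ifs <;> omega) (by simpa using h1) (by simpa using h0 _ _) t
  unfold SwapRel
  convert this using 1
  ext x y
  by_cases hx : x = Equiv.swap none (some o) i
  · subst hx
    simp
  · have hx' : Equiv.swap none (some o) x ≠ i := fun h => hx (by simp [← h])
    simp [hx, hx']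

theorem SwapRel.col {o : ι} (Y : Matrix (Option ι) (Option ι) ℤ) {i j : Option ι} (hij : i ≠ j)
    (h0 : ∀ x y, 0 ≤ Y x y) (h1 : 1 ≤ Y (Equiv.swap none (some o) i) j) (t : ℕ) :
    SwapRel o Y (Y * transvection i j (t : ℤ)) := by
  have := MatRel.col_transvection (Y.submatrix (Equiv.swap none (some o)) id)
    hij (fun x y => by
      have := h0 (Equiv.swap none (some o) x) y
      simp only [Matrix.add_apply, Matrix.one_apply, Matrix.submatrix_apply, id]
      split_ifs <;> omega) (by simpa using h1) (by simpa using h0 _ _) t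
  unfold SwapRel
  convert this using 1
  ext x y
  by_cases hy : y = j
  · subst hy
    simp
  · simp [hy]

theorem transvection_mul_bordered_none (u w : ι → ℤ) (X : Matrix ι ι ℤ) (x : ι) (c : ℤ) :
    transvection (some x) none c * bordered u w X = bordered (Function.update u x (u x + c)) w X := by
  ext r s
  rcases r with _ | r
  · rcases s with _ | s <;> simp [bordered]
  · by_cases hr : r = x
    · subst hr
      rcases s with _ | s <;> simp [bordered]
      ring
    · rcases s with _ | s <;> simp [bordered, hr]

theorem bordered_none_mul_transvection (u w : ι → ℤ) (X : Matrix ι ι ℤ) (y : ι) (c : ℤ) :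
    bordered u w X * transvection none (some y) c = bordered u (Function.update w y (w y + c)) X := by
  ext r s
  rcases s with _ | s
  · rcases r with _ | r <;> simp [bordered]
  · by_cases hs : s = y
    · subst hs
      rcases r with _ | r <;> simp [bordered]
      ring
    · rcases r with _ | r <;> simp [bordered, hs]

theorem transvection_mul_bordered (N : ℤ) (X : Matrix ι ι ℤ) {a b : ι} (c : ℤ) :
    transvection (some a) (some b) c * bordered (fun _ => N) (fun _ => 1) X =
      transvection (some a) none (c * N) *
        bordered (fun _ => N) (fun _ => 1) (transvection a b c * X) := by
  ext r s
  rcases r with _ | r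
  · rcases s with _ | s <;> simp [bordered]
  · by_cases hr : r = a
    · subst hr
      rcases s with _ | s <;> simp [bordered]
      ring
    · rcases s with _ | s <;> simp [bordered, hr]

theorem bordered_mul_transvection (N : ℤ) (X : Matrix ι ι ℤ) {a b : ι} (c : ℤ) :
    bordered (fun _ => N) (fun _ => 1) X * transvection (some a) (some b) c =
      bordered (fun _ => N) (fun _ => 1) (X * transvection a b c) *
        transvection none (some b) c := by
  ext r s
  rcases s with _ | s
  · rcases r with _ | r <;> simp [bordered]
  · by_cases hs : s = b
    · subst hs
      rcases r with _ | r <;> simp [bordered]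
      ring
    · rcases r with _ | r <;> simp [bordered, hs]

theorem MatRel.subdivide (X : Matrix ι ι ℤ) (h0 : ∀ x y, 0 ≤ X x y) (o : ι) (ho : 1 ≤ X o o) :
    MatRel X ((bordered 0 0 X).submatrix (Equiv.swap none (some o)) id) := by
  classical
  let M : Matrix (Option ι) (Option ι) ℤ := Matrix.of fun r c => match r, c with
    | none, none => -1
    | none, some y => X o y
    | some x, none => if x = o then 1 else 0
    | some x, some y => if x = o then 0 else X x y
  have s1 := MatMove.slide o (fun x y => ((1 + M) x y).toNat) (by simp [M])
    (fun x => by by_cases hx : x = o <;> simp [M, hx])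
    ⟨o, by simp [M]; omega⟩
  have s1' : MatRel M X := by
    unfold MatRel
    convert s1 using 1
    funext x y
    have := h0 x y
    have := h0 o y
    by_cases hx : x = o
    · subst hx
      by_cases hxy : x = y
      · subst hxy
        simp [M]
        omega
      · simp [M, hxy]
    · simp [M, hx, Matrix.one_apply]
  have s2 := MatRel.row_transvection M (i := none) (j := some o) (by simp) (by
      rintro (_ | x) (_ | y)
      · simp [M]
      · simp [M, h0]
      · simp [M]
        split_ifs <;> simp
      · have := h0 x y
        simp only [M, Matrix.add_apply, Matrix.one_apply, Matrix.of_apply]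
        split_ifs <;> omega) (by simpa [M] using ho) (by simp [M]) 1
  convert s1'.symm.trans s2 using 1
  ext r c
  rcases r with _ | r
  · rcases c with _ | c <;> simp [M, bordered]
  · by_cases hr : r = o
    · subst hr
      rcases c with _ | c <;> simp [M, bordered]
    · have : Equiv.swap none (some o) (some r) = some r :=
        Equiv.swap_apply_of_ne_of_ne (by simp) (by simpa using hr)
      rcases c with _ | c <;> simp [M, bordered, hr, this]

theorem swapRel_bordered_cols (X : Matrix ι ι ℤ) (h0 : ∀ x y, 0 ≤ X x y) (o : ι)
    (ho : ∀ y, 1 ≤ X o y) : SwapRel o (bordered 0 0 X) (bordered 0 (fun _ => 1) X) := by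
  have key : ∀ s : Finset ι, SwapRel o (bordered 0 0 X)
      (bordered 0 (fun y => if y ∈ s then 1 else 0) X) := by
    intro s
    induction s using Finset.induction_on with
    | empty => exact MatRel.refl _
    | insert a s ha ih =>
      refine MatRel.trans ih ?_
      have h := SwapRel.col (o := o) (bordered 0 (fun y => if y ∈ s then 1 else 0) X)
        (i := none) (j := some a) (by simp) (by
          rintro (_ | x) (_ | y) <;> simp [bordered, h0]
          split_ifs <;> simp) (by simpa [bordered] using ho a) 1
      rw [bordered_none_mul_transvection] at h
      unfold SwapRel at h
      convert h using 3
      funext y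
      by_cases hy : y = a
      · subst hy
        simp [ha]
      · simp [hy]
  simpa using key Finset.univ

theorem swapRel_bordered_rows (X : Matrix ι ι ℤ) (h0 : ∀ x y, 0 ≤ X x y) (o : ι)
    (ho : ∀ x, 1 ≤ X x o) (N : ℕ) :
    SwapRel o (bordered 0 (fun _ => 1) X) (bordered (fun _ => (N : ℤ)) (fun _ => 1) X) := by
  have key : ∀ s : Finset ι, SwapRel o (bordered 0 (fun _ => 1) X)
      (bordered (fun x => if x ∈ s then (N : ℤ) else 0) (fun _ => 1) X) := by
    intro s
    induction s using Finset.induction_on with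
    | empty => exact MatRel.refl _
    | insert a s ha ih =>
      refine MatRel.trans ih ?_
      have h := SwapRel.row (o := o)
        (bordered (fun x => if x ∈ s then (N : ℤ) else 0) (fun _ => 1) X)
        (i := some a) (j := none) (by simp) (by
          rintro (_ | x) (_ | y)
          · simp [bordered]
          · simp [bordered]
          · simp [bordered]
            split_ifs <;> simp
          · have := h0 x y
            simp [bordered]
            split_ifs <;> omega) (by simpa [bordered, ha] using ho a) N
      rw [transvection_mul_bordered_none] at h
      unfold SwapRel at h
      convert h using 3
      funext y
      by_cases hy : y = a
      · subst hy
        simp [ha]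
      · simp [hy]
  simpa using key Finset.univ

theorem MatRel.bordered (X : Matrix ι ι ℤ) (h0 : ∀ x y, 0 ≤ X x y) (o : ι)
    (ho : ∀ x, 1 ≤ X x o) (ho' : ∀ y, 1 ≤ X o y) (N : ℕ) :
    MatRel X ((bordered (fun _ => (N : ℤ)) (fun _ => 1) X).submatrix
      (Equiv.swap none (some o)) id) :=
  ((MatRel.subdivide X h0 o (ho o)).trans (swapRel_bordered_cols X h0 o ho')).trans
    (swapRel_bordered_rows X h0 o ho N)

/-- Matrices related by adding integer multiples of rows to other rows, and likewise for
columns. -/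
inductive TransvectionRel : Matrix ι ι ℤ → Matrix ι ι ℤ → Prop
  | refl (X : Matrix ι ι ℤ) : TransvectionRel X X
  | row {X Y : Matrix ι ι ℤ} {a b : ι} (hab : a ≠ b) (c : ℤ) (h : TransvectionRel X Y) :
      TransvectionRel X (transvection a b c * Y)
  | col {X Y : Matrix ι ι ℤ} {a b : ι} (hab : a ≠ b) (c : ℤ) (h : TransvectionRel X Y) :
      TransvectionRel X (Y * transvection a b c)

/-- Entrywise positivity of the bordered matrix for all large parameters. -/
theorem eventually_bordered_pos (X : Matrix ι ι ℤ) :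
    ∀ᶠ N : ℕ in Filter.atTop, ∀ r c, 1 ≤ bordered (fun _ => (N : ℤ)) (fun _ => 1) X r c := by
  have h : ∀ x y, ∀ᶠ N : ℕ in Filter.atTop, 1 ≤ (N : ℤ) + X x y := fun x y =>
    Filter.eventually_atTop.2 ⟨(1 - X x y).toNat, fun N hN => by omega⟩
  have h' : ∀ᶠ N : ℕ in Filter.atTop, ∀ x y, 1 ≤ (N : ℤ) + X x y :=
    Filter.eventually_all.2 fun x => Filter.eventually_all.2 fun y => h x y
  filter_upwards [h', Filter.eventually_ge_atTop 1] with N hN h1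
  rintro (_ | x) (_ | y)
  · simp [_root_.bordered]
  · simp [_root_.bordered]
  · simpa [_root_.bordered] using h1
  · simpa [_root_.bordered] using hN x y

theorem eventually_swapRel_row (o : ι) (X : Matrix ι ι ℤ) {a b : ι} (hab : a ≠ b) (t : ℕ) :
    ∀ᶠ N : ℕ in Filter.atTop, SwapRel o (bordered (fun _ => (N : ℤ)) (fun _ => 1) X)
      (bordered (fun _ => (N : ℤ)) (fun _ => 1) (transvection a b (t : ℤ) * X)) := by
  filter_upwards [eventually_bordered_pos X,
    eventually_bordered_pos (transvection a b (t : ℤ) * X)] with N h1 h2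
  have s1 := SwapRel.row (o := o) (bordered (fun _ => (N : ℤ)) (fun _ => 1) X)
    (i := some a) (j := some b) (by simpa using hab)
    (fun r c => zero_le_one.trans (h1 r c)) (h1 _ _) t
  have s2 := SwapRel.row (o := o)
    (bordered (fun _ => (N : ℤ)) (fun _ => 1) (transvection a b (t : ℤ) * X))
    (i := some a) (j := none) (by simp)
    (fun r c => zero_le_one.trans (h2 r c)) (h2 _ _) (t * N)
  rw [transvection_mul_bordered] at s1
  push_cast at s2
  exact MatRel.trans s1 (MatRel.symm s2)

theorem eventually_swapRel_col (o : ι) (X : Matrix ι ι ℤ) {a b : ι} (hab : a ≠ b) (t : ℕ) :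
    ∀ᶠ N : ℕ in Filter.atTop, SwapRel o (bordered (fun _ => (N : ℤ)) (fun _ => 1) X)
      (bordered (fun _ => (N : ℤ)) (fun _ => 1) (X * transvection a b (t : ℤ))) := by
  filter_upwards [eventually_bordered_pos X,
    eventually_bordered_pos (X * transvection a b (t : ℤ))] with N h1 h2
  have s1 := SwapRel.col (o := o) (bordered (fun _ => (N : ℤ)) (fun _ => 1) X)
    (i := some a) (j := some b) (by simpa using hab)
    (fun r c => zero_le_one.trans (h1 r c)) (h1 _ _) t
  have s2 := SwapRel.col (o := o)
    (bordered (fun _ => (N : ℤ)) (fun _ => 1) (X * transvection a b (t : ℤ)))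
    (i := none) (j := some b) (by simp)
    (fun r c => zero_le_one.trans (h2 r c)) (h2 _ _) t
  rw [bordered_mul_transvection] at s1
  exact MatRel.trans s1 (MatRel.symm s2)

theorem TransvectionRel.eventually_swapRel (o : ι) {X Y : Matrix ι ι ℤ}
    (h : TransvectionRel X Y) :
    ∀ᶠ N : ℕ in Filter.atTop, SwapRel o (bordered (fun _ => (N : ℤ)) (fun _ => 1) X)
      (bordered (fun _ => (N : ℤ)) (fun _ => 1) Y) := by
  induction h with
  | refl => exact Filter.Eventually.of_forall fun N => MatRel.refl _
  | @row Y a b hab c h ih =>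
    obtain ⟨t, rfl | rfl⟩ := c.eq_nat_or_neg
    · filter_upwards [ih, eventually_swapRel_row o Y hab t] with N h1 h2
      exact MatRel.trans h1 h2
    · filter_upwards [ih, eventually_swapRel_row o (transvection a b (-(t : ℤ)) * Y) hab t]
        with N h1 h2
      rw [← Matrix.mul_assoc, transvection_mul_transvection_same _ _ hab, add_neg_cancel,
        transvection_zero, Matrix.one_mul] at h2
      exact MatRel.trans h1 (MatRel.symm h2)
  | @col Y a b hab c h ih =>
    obtain ⟨t, rfl | rfl⟩ := c.eq_nat_or_neg
    · filter_upwards [ih, eventually_swapRel_col o Y hab t] with N h1 h2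
      exact MatRel.trans h1 h2
    · filter_upwards [ih, eventually_swapRel_col o (Y * transvection a b (-(t : ℤ))) hab t]
        with N h1 h2
      rw [Matrix.mul_assoc, transvection_mul_transvection_same _ _ hab, neg_add_cancel,
        transvection_zero, Matrix.mul_one] at h2
      exact MatRel.trans h1 (MatRel.symm h2)

/-- Nonnegative matrices with a positive row and column at the same index, which are related by
transvections, define move equivalent graphs. -/
theorem TransvectionRel.matRel {X Y : Matrix ι ι ℤ} (h : TransvectionRel X Y)
    (hX : ∀ x y, 0 ≤ X x y) (hY : ∀ x y, 0 ≤ Y x y) (o : ι) (h1 : ∀ x, 1 ≤ X x o)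
    (h2 : ∀ y, 1 ≤ X o y) (h3 : ∀ x, 1 ≤ Y x o) (h4 : ∀ y, 1 ≤ Y o y) : MatRel X Y := by
  obtain ⟨N, hN⟩ := (h.eventually_swapRel o).exists
  exact ((MatRel.bordered X hX o h1 h2 N).trans hN).trans (MatRel.bordered Y hY o h3 h4 N).symm

end Bordered

section Elementary

open Matrix

/-- The monoid generated by the transvections over the integers. -/
def elementaryMonoid (ι : Type) [Fintype ι] [DecidableEq ι] : Submonoid (Matrix ι ι ℤ) :=
  Submonoid.closure {T | ∃ a b, a ≠ b ∧ ∃ c, transvection a b c = T}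

variable {ι : Type} [Fintype ι] [DecidableEq ι]

theorem transvection_mem_elementaryMonoid {a b : ι} (hab : a ≠ b) (c : ℤ) :
    transvection a b c ∈ elementaryMonoid ι :=
  Submonoid.subset_closure ⟨a, b, hab, c, rfl⟩

theorem det_of_mem_elementaryMonoid {T : Matrix ι ι ℤ} (hT : T ∈ elementaryMonoid ι) :
    T.det = 1 := by
  induction hT using Submonoid.closure_induction with
  | mem T h =>
    obtain ⟨a, b, hab, c, rfl⟩ := h
    exact det_transvection_of_ne a b hab c
  | one => exact det_one
  | mul S T _ _ hS hT => rw [det_mul, hS, hT, one_mul]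

theorem exists_inv_of_mem_elementaryMonoid {T : Matrix ι ι ℤ} (hT : T ∈ elementaryMonoid ι) :
    ∃ S ∈ elementaryMonoid ι, S * T = 1 := by
  induction hT using Submonoid.closure_induction with
  | mem T h =>
    obtain ⟨a, b, hab, c, rfl⟩ := h
    exact ⟨_, transvection_mem_elementaryMonoid hab (-c), by
      rw [transvection_mul_transvection_same _ _ hab, neg_add_cancel, transvection_zero]⟩
  | one => exact ⟨1, one_mem _, one_mul 1⟩
  | mul S T _ _ hS hT =>
    obtain ⟨S', hS', h1⟩ := hS
    obtain ⟨T', hT', h2⟩ := hT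
    refine ⟨T' * S', mul_mem hT' hS', ?_⟩
    rw [Matrix.mul_assoc, ← Matrix.mul_assoc S', h1, Matrix.one_mul, h2]

theorem submatrix_mem_elementaryMonoid {κ : Type} [Fintype κ] [DecidableEq κ] (e : κ ≃ ι)
    {T : Matrix ι ι ℤ} (hT : T ∈ elementaryMonoid ι) :
    T.submatrix e e ∈ elementaryMonoid κ := by
  induction hT using Submonoid.closure_induction with
  | mem T h =>
    obtain ⟨a, b, hab, c, rfl⟩ := h
    convert transvection_mem_elementaryMonoid (e.symm.injective.ne hab) c using 1
    ext x y
    simp [transvection, Matrix.one_apply, Matrix.single_apply, Equiv.symm_apply_eq]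
  | one => rw [submatrix_one_equiv]; exact one_mem _
  | mul S T _ _ hS hT => rw [← submatrix_mul_equiv S T e e e]; exact mul_mem hS hT

theorem bordered_mem_elementaryMonoid {T : Matrix ι ι ℤ} (hT : T ∈ elementaryMonoid ι) :
    bordered 0 0 T ∈ elementaryMonoid (Option ι) := by
  induction hT using Submonoid.closure_induction_left with
  | one =>
    convert one_mem (elementaryMonoid (Option ι))
    ext (_ | x) (_ | y) <;> simp [bordered, Matrix.one_apply]
  | mul_left S h T _ hT =>
    obtain ⟨a, b, hab, c, rfl⟩ := h
    convert mul_mem (transvection_mem_elementaryMonoid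
      ((Option.some_injective ι).ne hab) c) hT using 1
    ext (_ | x) y
    · rcases y with _ | y <;> simp [bordered]
    · by_cases hx : x = a
      · subst hx
        rcases y with _ | y <;> simp [bordered]
      · rcases y with _ | y <;> simp [bordered, hx]

theorem bordered_zero_mem_elementaryMonoid {T : Matrix ι ι ℤ} (hT : T ∈ elementaryMonoid ι)
    (w : ι → ℤ) : bordered 0 w T ∈ elementaryMonoid (Option ι) := by
  have key : ∀ s : Finset ι,
      bordered 0 (fun y => if y ∈ s then w y else 0) T ∈ elementaryMonoid (Option ι) := by
    intro s
    induction s using Finset.induction_on with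
    | empty => exact bordered_mem_elementaryMonoid hT
    | insert a s ha ih =>
      have h := mul_mem ih (transvection_mem_elementaryMonoid (Option.some_ne_none a).symm (w a))
      rw [bordered_none_mul_transvection] at h
      convert h using 2
      funext y
      by_cases hy : y = a
      · subst hy
        simp [ha]
      · simp [hy]
  simpa using key Finset.univ

theorem det_bordered_zero (w : ι → ℤ) (X : Matrix ι ι ℤ) : (bordered 0 w X).det = X.det := by
  have h : (bordered 0 w X).submatrix (Equiv.optionEquivSumPUnit.{0} ι).symm
      (Equiv.optionEquivSumPUnit.{0} ι).symm =
      fromBlocks X 0 (Matrix.of fun _ y => w y) (1 : Matrix PUnit.{1} PUnit.{1} ℤ) := by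
    ext (x | x) (y | y) <;> simp [bordered]
  rw [← det_submatrix_equiv_self (Equiv.optionEquivSumPUnit.{0} ι).symm, h, det_fromBlocks_zero₁₂,
    det_one, mul_one]

theorem transvection_mulVec_eq_update (i j : ι) (c : ℤ) (v : ι → ℤ) :
    transvection i j c *ᵥ v = Function.update v i (v i + c * v j) := by
  ext x
  by_cases hx : x = i
  · subst hx
    simp [transvection, add_mulVec, single_mulVec]
  · simp [transvection, add_mulVec, single_mulVec, hx]

theorem exists_elementary_mulVec_support [Nonempty ι] (v : ι → ℤ) :
    ∃ T ∈ elementaryMonoid ι, ∃ j, ∀ i, i ≠ j → (T *ᵥ v) i = 0 := by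
  induction hN : ∑ i, (v i).natAbs using Nat.strong_induction_on generalizing v with
  | _ N ih =>
  by_cases h : ∃ i j, i ≠ j ∧ v i ≠ 0 ∧ v j ≠ 0 ∧ (v i).natAbs ≤ (v j).natAbs
  · obtain ⟨i, j, hij, hi, hj, hle⟩ := h
    have hw : ∀ x, (transvection j i (-(v j / v i)) *ᵥ v) x =
        if x = j then v j % v i else v x := by
      intro x
      rw [transvection_mulVec_eq_update, Function.update_apply]
      split_ifs
      · rw [Int.emod_def]
        ring
      · rfl
    have hlt : (v j % v i).natAbs < (v i).natAbs := by
      have h1 := Int.emod_nonneg (v j) hi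
      have h2 := Int.emod_lt_abs (v j) hi
      rw [Int.abs_eq_natAbs] at h2
      omega
    obtain ⟨T, hT, k, hk⟩ := ih (∑ x, ((transvection j i (-(v j / v i)) *ᵥ v) x).natAbs) (by
      rw [← hN]
      refine Finset.sum_lt_sum (fun x _ => ?_) ⟨j, Finset.mem_univ _, ?_⟩
      · rw [hw]
        split_ifs with hx
        · subst hx
          omega
        · exact le_rfl
      · rw [hw, if_pos rfl]
        omega) _ rfl
    rw [mulVec_mulVec] at hk
    exact ⟨_, mul_mem hT (transvection_mem_elementaryMonoid hij.symm _), k, hk⟩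
  · push Not at h
    refine ⟨1, one_mem _, ?_⟩
    by_cases hv : ∃ j, v j ≠ 0
    · obtain ⟨j, hj⟩ := hv
      refine ⟨j, fun i hij => ?_⟩
      rw [one_mulVec]
      by_contra hi
      have h1 := h i j hij hi hj
      have h2 := h j i hij.symm hj hi
      omega
    · push Not at hv
      exact ⟨Classical.arbitrary ι, fun i _ => by rw [one_mulVec, hv]⟩

theorem exists_elementary_mulVec_eq_single [Nonempty ι] (v : Option ι → ℤ) (j : Option ι)
    (hj : v j * v j = 1) (hv : ∀ i, i ≠ j → v i = 0) :
    ∃ T ∈ elementaryMonoid (Option ι), T *ᵥ v = Pi.single none 1 := by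
  have key : ∀ (k : ι) (w : Option ι → ℤ), w (some k) * w (some k) = 1 →
      (∀ i, i ≠ none → i ≠ some k → w i = 0) → (w none = 0 ∨ w none = -w (some k)) →
      ∃ T ∈ elementaryMonoid (Option ι), T *ᵥ w = Pi.single none 1 := by
    intro k w hk hw h0
    refine ⟨transvection (some k) none (-w (some k)) *
      transvection none (some k) ((1 - w none) * w (some k)),
      mul_mem (transvection_mem_elementaryMonoid (by simp) _)
        (transvection_mem_elementaryMonoid (by simp) _), ?_⟩
    rw [← mulVec_mulVec, transvection_mulVec_eq_update, transvection_mulVec_eq_update]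
    ext i
    by_cases hi : i = none
    · subst hi
      simp
      linear_combination (1 - w none) * hk
    · by_cases hik : i = some k
      · subst hik
        simp
        linear_combination (-w (some k)) * (1 - w none) * hk
      · simp [hi, hik, hw i hi hik]
  rcases j with _ | k
  · obtain ⟨k⟩ := ‹Nonempty ι›
    obtain ⟨T, hT, h⟩ := key k (transvection (some k) none (-1) *ᵥ v)
      (by simp [transvection_mulVec_eq_update, hv, hj])
      (fun i hi hik => by simp [transvection_mulVec_eq_update, hv, hi, hik])
      (by simp [transvection_mulVec_eq_update, hv])
    exact ⟨_, mul_mem hT (transvection_mem_elementaryMonoid (Option.some_ne_none k) _), by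
      rw [← mulVec_mulVec, h]⟩
  · exact key k v hj (fun i _ h => hv i h) (Or.inl (hv none (by simp)))

theorem mem_elementaryMonoid_option (ih : ∀ A : Matrix ι ι ℤ, A.det = 1 → A ∈ elementaryMonoid ι)
    (A : Matrix (Option ι) (Option ι) ℤ) (hA : A.det = 1) : A ∈ elementaryMonoid (Option ι) := by
  rcases isEmpty_or_nonempty ι with hι | hι
  · rw [det_unique] at hA
    convert one_mem (elementaryMonoid (Option ι))
    ext x y
    rw [Subsingleton.elim x default, Subsingleton.elim y default, hA]
    simp
  obtain ⟨T, hT, j, hj⟩ := exists_elementary_mulVec_support (fun x => A x none)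
  have hTA : (T * A).det = 1 := by rw [det_mul, det_of_mem_elementaryMonoid hT, hA, one_mul]
  have hcol : ∀ x, (T * A) x none = (T *ᵥ fun x => A x none) x := fun x => rfl
  have hunit : IsUnit ((T * A) j none) := by
    have h := congrFun (congrFun (adjugate_mul (T * A)) none) none
    rw [hTA, one_smul, Matrix.mul_apply, Finset.sum_eq_single j (fun i _ hi => by
      rw [hcol, hj i hi, mul_zero]) (by simp)] at h
    exact IsUnit.of_mul_eq_one_right _ (h.trans (by simp))
  obtain ⟨S, hS, h⟩ := exists_elementary_mulVec_eq_single (fun x => (T * A) x none) j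
    (by rcases Int.isUnit_iff.1 hunit with h | h <;> simp [h])
    (fun i hi => (hcol i).trans (hj i hi))
  have hST := mul_mem hS hT
  obtain ⟨R, hR, hRST⟩ := exists_inv_of_mem_elementaryMonoid hST
  have hsplit : S * T * A = bordered 0 (fun y => (S * T * A) none (some y))
      (Matrix.of fun x y => (S * T * A) (some x) (some y)) := by
    have hcol' : ∀ x, (S * T * A) x none = (Pi.single none 1 : Option ι → ℤ) x := fun x => by
      rw [← h, Matrix.mul_assoc]
      rfl
    ext (_ | x) (_ | y) <;> simp [bordered, hcol']
  have hdet : (S * T * A).det = 1 := by rw [det_mul, det_of_mem_elementaryMonoid hST, hA, one_mul]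
  have hmem : S * T * A ∈ elementaryMonoid (Option ι) := by
    rw [hsplit] at hdet ⊢
    rw [det_bordered_zero] at hdet
    exact bordered_zero_mem_elementaryMonoid (ih _ hdet) _
  have := mul_mem hR hmem
  rwa [← Matrix.mul_assoc, hRST, Matrix.one_mul] at this

/-- Integer matrices of determinant one are products of transvections. -/
theorem mem_elementaryMonoid_of_det_eq_one {n : ℕ} (A : Matrix (Fin n) (Fin n) ℤ)
    (hA : A.det = 1) : A ∈ elementaryMonoid (Fin n) := by
  induction n with
  | zero =>
    rw [Subsingleton.elim A 1]
    exact one_mem _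
  | succ n ih =>
    have h := submatrix_mem_elementaryMonoid (finSuccEquiv n)
      (mem_elementaryMonoid_option ih (A.submatrix (finSuccEquiv n).symm (finSuccEquiv n).symm)
        (by rw [det_submatrix_equiv_self, hA]))
    simpa using h

theorem TransvectionRel.mul_left {T X Y : Matrix ι ι ℤ} (hT : T ∈ elementaryMonoid ι)
    (h : TransvectionRel X Y) : TransvectionRel X (T * Y) := by
  induction hT using Submonoid.closure_induction_left with
  | one => rwa [Matrix.one_mul]
  | mul_left S hS T _ ih =>
    obtain ⟨a, b, hab, c, rfl⟩ := hS
    rw [Matrix.mul_assoc]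
    exact .row hab c ih

theorem TransvectionRel.mul_right {T X Y : Matrix ι ι ℤ} (hT : T ∈ elementaryMonoid ι)
    (h : TransvectionRel X Y) : TransvectionRel X (Y * T) := by
  induction hT using Submonoid.closure_induction_right with
  | one => rwa [Matrix.mul_one]
  | mul_right T _ S hS ih =>
    obtain ⟨a, b, hab, c, rfl⟩ := hS
    rw [← Matrix.mul_assoc]
    exact .col hab c ih

/-- Two integer matrices with the same Smith normal form are related by transvections provided
that the determinants of the base changes agree, or that one may change a sign. -/
theorem transvectionRel_of_smith {n : ℕ} {P Q P' Q' D E : Matrix (Fin n) (Fin n) ℤ}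
    (hP : IsUnit P.det) (hQ : IsUnit Q.det) (hP' : IsUnit P'.det) (hQ' : IsUnit Q'.det)
    (hE : E.det = -1) (hED : E * D * E = D)
    (h : P.det * Q.det = P'.det * Q'.det ∨ (E * D = D ∧ D * E = D)) :
    TransvectionRel (P * D * Q) (P' * D * Q') := by
  have hinv : ∀ R : Matrix (Fin n) (Fin n) ℤ, IsUnit R.det →
      ∃ S : Matrix (Fin n) (Fin n) ℤ, S * R = 1 ∧ R * S = 1 ∧ S.det = R.det := fun R hR => by
    refine ⟨R⁻¹, nonsing_inv_mul R hR, mul_nonsing_inv R hR, ?_⟩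
    have h1 := congrArg det (nonsing_inv_mul R hR)
    rw [det_mul, det_one] at h1
    rcases Int.isUnit_iff.1 hR with h | h <;> rw [h] at h1 ⊢ <;> omega
  obtain ⟨P₁, h1, -, hP₁⟩ := hinv P hP
  obtain ⟨Q₁, -, h2, hQ₁⟩ := hinv Q hQ
  have key : ∀ U V : Matrix (Fin n) (Fin n) ℤ, U * D * V = D → U.det = P'.det * P.det →
      V.det = Q'.det * Q.det → TransvectionRel (P * D * Q) (P' * D * Q') := by
    intro U V hUV hU hV
    have hl : (P' * U * P₁).det = 1 := by
      rw [det_mul, det_mul, hP₁, hU]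
      rcases Int.isUnit_iff.1 hP with h | h <;> rcases Int.isUnit_iff.1 hP' with h' | h' <;>
        simp [h, h']
    have hr : (Q₁ * V * Q').det = 1 := by
      rw [det_mul, det_mul, hQ₁, hV]
      rcases Int.isUnit_iff.1 hQ with h | h <;> rcases Int.isUnit_iff.1 hQ' with h' | h' <;>
        simp [h, h']
    have h3 := TransvectionRel.mul_right (mem_elementaryMonoid_of_det_eq_one _ hr)
      (TransvectionRel.mul_left (mem_elementaryMonoid_of_det_eq_one _ hl)
        (.refl (X := P * D * Q)))
    have h4 : P' * U * P₁ * (P * D * Q) * (Q₁ * V * Q') = P' * D * Q' := by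
      calc _ = P' * U * (P₁ * P) * D * (Q * Q₁) * V * Q' := by simp only [Matrix.mul_assoc]
        _ = P' * (U * D * V) * Q' := by
          rw [h1, h2, Matrix.mul_one, Matrix.mul_one]
          simp only [Matrix.mul_assoc]
        _ = _ := by rw [hUV]
    rwa [h4] at h3
  have hmix : (P'.det * P.det) * (Q'.det * Q.det) = -1 → E * D = D ∧ D * E = D := fun hm => by
    refine h.resolve_left fun he => ?_
    have h1 : (P'.det * P.det) * (Q'.det * Q.det) = (P'.det * Q'.det) * (P'.det * Q'.det) := by
      rw [← he]
      linear_combination (P.det * Q.det) * -he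
    nlinarith [mul_self_nonneg (P'.det * Q'.det)]
  rcases Int.isUnit_iff.1 (hP'.mul hP) with hp | hp <;>
    rcases Int.isUnit_iff.1 (hQ'.mul hQ) with hq | hq
  · exact key 1 1 (by simp) (by simp [hp]) (by simp [hq])
  · exact key 1 E (by simpa using (hmix (by simp [hp, hq])).2) (by simp [hp]) (by simp [hE, hq])
  · exact key E 1 (by simpa using (hmix (by simp [hp, hq])).1) (by simp [hE, hp]) (by simp [hq])
  · exact key E E hED (by simp [hE, hp]) (by simp [hE, hq])

end Elementary

open Matrix in
/-- Interpolates between the standard form (`t = 0`) and a matrix whose row and column of index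
`k - 1` are positive (`t = k - 1`). -/
def cascade (n : ℕ) (d : ℕ → ℤ) (k t : ℕ) : Matrix (Fin n) (Fin n) ℤ :=
  Matrix.of fun r c =>
    if r.1 < k then
      if r.1 ≤ t then
        (if c.1 < r.1 then d c.1 else 0) + if k ≤ c.1 + 1 then d (k - 1) else 0
      else if c.1 + 1 = r.1 then d c.1 else 0
    else if k ≤ c.1 + 1 then d (k - 1) else 0

section Cascade

open Matrix

variable {n k : ℕ} {d : ℕ → ℤ}

theorem transvection_mul_cascade {t : ℕ} (ht : t + 1 < k) (hk : k ≤ n) :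
    transvection (⟨t + 1, by omega⟩ : Fin n) ⟨t, by omega⟩ (1 : ℤ) * cascade n d k t =
      cascade n d k (t + 1) := by
  ext r c
  by_cases hr : r = ⟨t + 1, by omega⟩
  · subst hr
    rw [transvection_mul_apply_same]
    simp only [cascade, Matrix.of_apply]
    grind
  · rw [transvection_mul_apply_of_ne _ _ _ _ hr]
    have : r.1 ≠ t + 1 := fun h => hr (Fin.ext h)
    simp only [cascade, Matrix.of_apply]
    grind

theorem cascade_nonneg (hd : ∀ i, 0 ≤ d i) (t : ℕ) (x y : Fin n) : 0 ≤ cascade n d k t x y := by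
  have h1 := hd y
  have h2 := hd (k - 1)
  simp only [cascade, Matrix.of_apply]
  split_ifs <;> omega

theorem TransvectionRel.cascade {X : Matrix (Fin n) (Fin n) ℤ} (hk : k ≤ n)
    (h : TransvectionRel X (cascade n d k 0)) {t : ℕ} (ht : t < k) :
    TransvectionRel X (cascade n d k t) := by
  induction t with
  | zero => exact h
  | succ t ih =>
    rw [← transvection_mul_cascade ht hk]
    exact .row (by simp [Fin.ext_iff]) _ (ih (by omega))

theorem MatRel.cascade (hk : k ≤ n) (hd : ∀ i, 0 ≤ d i) (hdk : ∀ i < k, 1 ≤ d i) {t : ℕ}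
    (ht : t < k) : MatRel (cascade n d k 0) (cascade n d k t) := by
  induction t with
  | zero => exact .refl _
  | succ t ih =>
    refine (ih (by omega)).trans ?_
    rw [← transvection_mul_cascade ht hk]
    refine MatRel.row_transvection _ (by simp [Fin.ext_iff]) (fun x y => ?_) ?_
      (cascade_nonneg hd _ _ _) 1
    · have := cascade_nonneg (k := k) hd t x y
      simp only [Matrix.add_apply, Matrix.one_apply]
      split_ifs <;> omega
    · have := hdk t (by omega)
      simpa [_root_.cascade, ht] using this

theorem cascade_eq_mul (hk0 : 0 < k) (hk : k ≤ n) (hd0 : ∀ i, k ≤ i → d i = 0) :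
    ∃ P Q : Matrix (Fin n) (Fin n) ℤ, P.det = (-1) ^ (k - 1) ∧ Q.det = 1 ∧
      cascade n d k 0 = P * Matrix.diagonal (fun i : Fin n => d i) * Q := by
  have : NeZero n := ⟨by omega⟩
  set j : Fin n := ⟨k - 1, by omega⟩ with hj
  set σ : Equiv.Perm (Fin n) := j.cycleRange⁻¹ with hσ
  have hσ_zero : σ 0 = j := by
    rw [hσ, Equiv.Perm.inv_eq_iff_eq, Fin.cycleRange_self]
  have hσ_lt : ∀ r : Fin n, r ≠ 0 → r.1 < k → (σ r).1 + 1 = r.1 := by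
    intro r hr hrk
    have hr' : r.1 ≠ 0 := fun h => hr (Fin.ext h)
    have : σ r = ⟨r.1 - 1, by omega⟩ := by
      rw [hσ, Equiv.Perm.inv_eq_iff_eq, Fin.ext_iff, Fin.coe_cycleRange_of_lt]
      · simp; omega
      · rw [Fin.lt_def]; simp [hj]; omega
    rw [this]; simp; omega
  have hσ_ge : ∀ r : Fin n, k ≤ r.1 → σ r = r := by
    intro r hr
    rw [hσ, Equiv.Perm.inv_eq_iff_eq, Fin.cycleRange_of_gt]
    rw [Fin.lt_def]; simp [hj]; omega
  set u : Fin n → ℤ := fun r => if k ≤ r.1 then 1 else 0 with hu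
  set X : Matrix (Fin n) (Fin n) ℤ := σ.permMatrix ℤ * Matrix.diagonal (fun i : Fin n => d i) *
    (1 + vecMulVec (Pi.single j 1) u) with hX
  have hXa : ∀ r c, X r c = (if σ r = c then d c else 0) +
      (if σ r = j then d (k - 1) else 0) * u c := by
    intro r c
    rw [hX, Matrix.mul_add, Matrix.mul_one, Matrix.add_apply, Matrix.mul_vecMulVec, vecMulVec_apply,
      Matrix.mulVec_single_one]
    simp [Matrix.mul_diagonal, PEquiv.toMatrix_apply, Equiv.Perm.permMatrix, hj]
  have hLdet : ∀ a b : Fin n → ℤ, (1 + vecMulVec a b).det = 1 + b ⬝ᵥ a := by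
    intro a b
    rw [vecMulVec_eq Unit, Matrix.det_one_add_replicateCol_mul_replicateRow]
  refine ⟨(1 + vecMulVec u (Pi.single 0 1)) * σ.permMatrix ℤ, 1 + vecMulVec (Pi.single j 1) u,
    ?_, ?_, ?_⟩
  · rw [det_mul, hLdet, det_permutation, hσ, Equiv.Perm.sign_inv, Fin.sign_cycleRange]
    simp [hu, hj, hk0.ne']
  · rw [hLdet]
    simp [hu, hj]
    omega
  · rw [Matrix.mul_assoc, Matrix.mul_assoc, ← Matrix.mul_assoc (σ.permMatrix ℤ), ← hX,
      Matrix.add_mul, Matrix.one_mul, vecMulVec_mul, Matrix.single_one_vecMul]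
    ext r c
    rw [Matrix.add_apply, vecMulVec_apply, hXa, Matrix.row_apply, hXa, hσ_zero]
    simp only [cascade, Matrix.of_apply, hu]
    have h0 : (0 : Fin n).1 = 0 := rfl
    rcases eq_or_ne r 0 with rfl | hr
    · rw [hσ_zero]
      have h1 : j = c ↔ c.1 + 1 = k := by rw [Fin.ext_iff]; simp [hj]; omega
      simp only [h1]
      grind
    · have hr' : r.1 ≠ 0 := fun h => hr (Fin.ext h)
      have h1 : j = c ↔ c.1 + 1 = k := by rw [Fin.ext_iff]; simp [hj]; omega
      rcases lt_or_ge r.1 k with hrk | hrk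
      · have h2 := hσ_lt r hr hrk
        have h3 : ¬ σ r = j := by rw [Fin.ext_iff]; simp [hj]; omega
        have h4 : σ r = c ↔ c.1 + 1 = r.1 := by rw [Fin.ext_iff]; omega
        simp only [h3, h4]
        grind
      · have h2 := hσ_ge r hrk
        have h3 : ¬ r = j := by rw [Fin.ext_iff]; simp [hj]; omega
        have h4 : (if r = c then d c else 0) = 0 := by
          split_ifs with h
          · subst h; exact hd0 _ hrk
          · rfl
        simp only [h2, h3, h4, h1]
        grind

end Cascade

/-- In a Smith normal form the nonzero diagonal entries are exactly the first `rank` ones. -/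
theorem ne_zero_iff_lt_rank_diagonal {n : ℕ} (dd : ℕ → ℕ)
    (hdvd : ∀ i, i + 1 < n → dd i ∣ dd (i + 1)) {i : ℕ} (hi : i < n) :
    dd i ≠ 0 ↔ i < (Matrix.diagonal fun i : Fin n => (dd i.1 : ℤ)).rank := by
  classical
  set D := Matrix.diagonal fun i : Fin n => (dd i.1 : ℤ) with hD
  have hz : ∀ i j, i ≤ j → j < n → dd i = 0 → dd j = 0 := by
    intro i j hij hj h0
    induction j, hij using Nat.le_induction with
    | base => exact h0
    | succ j hij ih =>
      have := hdvd j hj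
      rw [ih (by omega)] at this
      exact Nat.eq_zero_of_zero_dvd this
  constructor
  · intro h
    have hlt : i + 1 ≤ n := hi
    have h1 := Matrix.rank_submatrix_le D (Fin.castLE hlt) (Fin.castLE hlt)
    have h2 : D.submatrix (Fin.castLE hlt) (Fin.castLE hlt) =
        Matrix.diagonal fun x : Fin (i + 1) => (dd x.1 : ℤ) :=
      Matrix.submatrix_diagonal _ _ (Fin.castLE_injective hlt)
    have h3 : (D.submatrix (Fin.castLE hlt) (Fin.castLE hlt)).rank = Fintype.card (Fin (i + 1)) := by
      apply Matrix.rank_of_det_ne_zero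
      rw [h2, Matrix.det_diagonal, Finset.prod_ne_zero_iff]
      intro x _ hx
      exact h (hz x i (by omega) hi (by exact_mod_cast hx))
    rw [Fintype.card_fin] at h3
    omega
  · intro h h0
    have h1 := D.rank_le_card_of_support_subset (Finset.univ.filter fun x : Fin n => x.1 < i) (by
      intro x hx
      simp only [Finset.coe_filter, Finset.mem_univ, true_and, Set.mem_ofPred_eq]
      by_contra hxi
      apply hx
      ext y
      have : dd x = 0 := hz i x (by omega) x.2 h0
      simp [hD, Matrix.diagonal_apply, this])
    have h2 : (Finset.univ.filter fun x : Fin n => x.1 < i).card = i := by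
      rw [show (Finset.univ.filter fun x : Fin n => x.1 < i) = Finset.Iio ⟨i, hi⟩ by
        ext x; simp [Fin.lt_def], Fin.card_Iio]
    omega

theorem rank_neg_mul_mul {n : ℕ} {P D Q : Matrix (Fin n) (Fin n) ℤ} (hP : IsUnit P.det)
    (hQ : IsUnit Q.det) : (-(P * D * Q)).rank = D.rank := by
  have hP' : IsUnit (-P).det := by
    rw [Matrix.det_neg]
    exact (isUnit_one.neg.pow _).mul hP
  rw [← Matrix.neg_mul, ← Matrix.neg_mul, Matrix.rank_mul_eq_left_of_isUnit_det _ _ hQ,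
    Matrix.rank_mul_eq_right_of_isUnit_det _ _ hP']

/-- A matrix in Smith normal form with nonpositive `det (-B)` is related by transvections to
the standard form. -/
theorem transvectionRel_cascade {n : ℕ} (hn : 0 < n) {P Q : Matrix (Fin n) (Fin n) ℤ}
    {dd : ℕ → ℕ} {k : ℕ} (hP : IsUnit P.det) (hQ : IsUnit Q.det) (hk0 : 0 < k) (hk : k ≤ n)
    (hdd : ∀ i < n, dd i ≠ 0 ↔ i < k) {D : Matrix (Fin n) (Fin n) ℤ}
    (hD : D = Matrix.diagonal fun i : Fin n => (dd i.1 : ℤ))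
    (hdet : (-(P * D * Q)).det ≤ 0) :
    TransvectionRel (P * D * Q) (cascade n (fun i => if i < n then (dd i : ℤ) else 0) k 0) := by
  obtain ⟨P', Q', hP', hQ', h⟩ := cascade_eq_mul (n := n) (k := k)
    (d := fun i => if i < n then (dd i : ℤ) else 0) hk0 hk (by
      intro i hi
      split_ifs with hin
      · have := (hdd i hin).not.2 (by omega)
        simpa using this
      · rfl)
  have hD' : (Matrix.diagonal fun i : Fin n => if i.1 < n then (dd i.1 : ℤ) else 0) = D := by
    simp [hD]
  rw [h, hD']
  set e : Fin n → ℤ := fun i => if i = ⟨n - 1, by omega⟩ then -1 else 1 with he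
  have hee : ∀ i, e i * e i = 1 := by
    intro i; simp only [he]; split_ifs <;> norm_num
  refine transvectionRel_of_smith (E := Matrix.diagonal e) hP hQ ?_ ?_ ?_ ?_ ?_
  · rw [hP']; exact isUnit_one.neg.pow _
  · rw [hQ']; exact isUnit_one
  · rw [Matrix.det_diagonal]
    simp [he]
  · rw [hD, Matrix.diagonal_mul_diagonal, Matrix.diagonal_mul_diagonal]
    congr 1; ext i
    rw [mul_right_comm, hee, one_mul]
  · rcases hk.lt_or_eq with hlt | rfl
    · right
      have : ∀ i : Fin n, e i * (dd i.1 : ℤ) = dd i.1 := by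
        intro i
        simp only [he]
        split_ifs with hi
        · have := (hdd i i.2).not.2 (by simp [hi]; omega)
          simp only [ne_eq, not_not] at this
          simp [this]
        · simp
      constructor
      · rw [hD, Matrix.diagonal_mul_diagonal]
        simp only [this]
      · rw [hD, Matrix.diagonal_mul_diagonal]
        simp only [mul_comm _ (e _), this]
    · left
      have hpos : 0 < D.det := by
        rw [hD, Matrix.det_diagonal]
        apply Finset.prod_pos
        intro i _
        have := (hdd i i.2).2 i.2
        positivity
      rw [hP', hQ', mul_one]
      rw [Matrix.det_neg, Matrix.det_mul, Matrix.det_mul, Fintype.card_fin] at hdet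
      obtain ⟨m, rfl⟩ : ∃ m, k = m + 1 := ⟨k - 1, by omega⟩
      have hPQ : IsUnit (P.det * Q.det) := hP.mul hQ
      rw [pow_succ] at hdet
      have h2 : 0 ≤ ((-1) ^ m * (P.det * Q.det)) * D.det := by linarith
      have h3 : 0 ≤ (-1) ^ m * (P.det * Q.det) := nonneg_of_mul_nonneg_left h2 hpos
      rw [Nat.add_sub_cancel]
      rcases Int.isUnit_iff.1 hPQ with h | h <;> rcases neg_one_pow_eq_or ℤ m with h' | h' <;>
        rw [h, h'] at h3 ⊢ <;> norm_num at h3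

/-- The graph of a matrix over `ℕ` agrees with the graph of the same matrix over `ℕ∞`. -/
theorem matGraph_iso_graphOfMatrix {n : ℕ} (A : Matrix (Fin n) (Fin n) ℕ) :
    Nonempty (CKGraph.Iso (matGraph fun x y => A x y)
      (graphOfMatrix (A.map ((↑) : ℕ → ℕ∞)))) := by
  refine matGraph_iso_of_fibers _ _ (Equiv.refl _) fun x y => ?_
  refine ⟨fun f => ⟨⟨x, y, f.1, by simp⟩, rfl, rfl⟩, ?_, ?_⟩
  · intro f g h
    exact Fin.ext (congrArg
      (fun e : (Σ x : Fin n, Σ y : Fin n, {k : ℕ // (k : ℕ∞) < A.map ((↑) : ℕ → ℕ∞) x y}) =>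
        e.2.2.1) (congrArg Subtype.val h))
  · rintro ⟨⟨x', y', f, hf⟩, h1, h2⟩
    obtain rfl : x' = x := h1
    obtain rfl : y' = y := h2
    exact ⟨⟨f, by simpa [Matrix.map_apply] using hf⟩, rfl⟩

theorem MatRel.matMoveEquiv {n : ℕ} {X Y : Matrix (Fin n) (Fin n) ℕ}
    (h : MatRel (X.map ((↑) : ℕ → ℤ)) (Y.map ((↑) : ℕ → ℤ))) :
    MatMoveEquiv ((1 + X).map ((↑) : ℕ → ℕ∞)) ((1 + Y).map ((↑) : ℕ → ℕ∞)) := by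
  have key : ∀ X : Matrix (Fin n) (Fin n) ℕ,
      (fun x y => ((1 + X.map ((↑) : ℕ → ℤ)) x y).toNat) = fun x y => (1 + X) x y := by
    intro X
    ext x y
    simp only [Matrix.add_apply, Matrix.one_apply, Matrix.map_apply]
    split_ifs <;> omega
  have h' := MatMove.moveEquiv h
  rw [key, key] at h'
  have hfin : Finite (Fin n) := inferInstance
  exact .trans (.symm (.of_iso hfin (matGraph_iso_graphOfMatrix (1 + X))))
    (.trans h' (.of_iso hfin (matGraph_iso_graphOfMatrix (1 + Y))))

/-- Standard form, regular case. -/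
theorem stmt17 {n : ℕ} (hn : 1 < n) (B : Matrix (Fin n) (Fin n) ℕ)
    (hpos : ∀ i j, 0 < B i j)
    (dd : ℕ → ℕ)
    (hdddvd : ∀ i, i + 1 < n → dd i ∣ dd (i + 1))
    (hSNF : ∃ P Q : Matrix (Fin n) (Fin n) ℤ, IsUnit P.det ∧ IsUnit Q.det ∧
      B.map ((↑) : ℕ → ℤ) =
        P * Matrix.diagonal (fun i : Fin n => (dd i.1 : ℤ)) * Q)
    (k : ℕ) (hk : k = (-(B.map ((↑) : ℕ → ℤ))).rank)
    (hdet : Matrix.det (-(B.map ((↑) : ℕ → ℤ))) ≤ 0) :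
    MatMoveEquiv ((1 + B).map ((↑) : ℕ → ℕ∞))
      ((1 + Matrix.of fun r c : Fin n =>
        if r.1 = 0 then (if k ≤ c.1 + 1 then dd (k - 1) else 0)
        else if r.1 < k then (if c.1 + 1 = r.1 then dd (r.1 - 1) else 0)
        else (if k ≤ c.1 + 1 then dd (k - 1) else 0)).map ((↑) : ℕ → ℕ∞)) := by
  obtain ⟨P, Q, hP, hQ, hB⟩ := hSNF
  set D := Matrix.diagonal fun i : Fin n => (dd i.1 : ℤ) with hD
  have hkD : k = D.rank := by rw [hk, hB, rank_neg_mul_mul hP hQ]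
  have hkn : k ≤ n := by
    rw [hkD]
    simpa using D.rank_le_card_width
  have hdd : ∀ i < n, dd i ≠ 0 ↔ i < k := fun i hi => by
    rw [hkD]
    exact ne_zero_iff_lt_rank_diagonal dd hdddvd hi
  have hk0 : 0 < k := by
    by_contra hk0
    have hD0 : D = 0 := by
      ext i j
      have h0 : dd i = 0 := not_not.1 ((hdd i i.2).not.2 (by omega))
      simp [hD, Matrix.diagonal_apply, h0]
    have h00 := congrFun₂ hB ⟨0, by omega⟩ ⟨0, by omega⟩
    rw [hD0, Matrix.mul_zero, Matrix.zero_mul] at h00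
    have := hpos ⟨0, by omega⟩ ⟨0, by omega⟩
    simp only [Matrix.map_apply, Matrix.zero_apply, Nat.cast_eq_zero] at h00
    omega
  set d : ℕ → ℤ := fun i => if i < n then (dd i : ℤ) else 0 with hd
  have hd0 : ∀ i, 0 ≤ d i := fun i => by
    simp only [hd]
    split_ifs <;> omega
  have hd1 : ∀ i < k, 1 ≤ d i := fun i hi => by
    have := (hdd i (by omega)).2 hi
    simp only [hd, if_pos (hi.trans_le hkn)]
    omega
  apply MatRel.matMoveEquiv
  have hstd : (Matrix.of fun r c : Fin n =>
        if r.1 = 0 then (if k ≤ c.1 + 1 then dd (k - 1) else 0)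
        else if r.1 < k then (if c.1 + 1 = r.1 then dd (r.1 - 1) else 0)
        else (if k ≤ c.1 + 1 then dd (k - 1) else 0)).map ((↑) : ℕ → ℤ) =
      cascade n d k 0 := by
    ext r c
    have hdc : d c.1 = dd c.1 := if_pos c.2
    have hdk : d (k - 1) = dd (k - 1) := if_pos (by omega)
    simp only [cascade, Matrix.of_apply, Matrix.map_apply, hdc, hdk]
    grind
  rw [hstd]
  have hrel : TransvectionRel (B.map ((↑) : ℕ → ℤ)) (cascade n d k (k - 1)) := by
    refine TransvectionRel.cascade hkn ?_ (by omega)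
    rw [hB] at hdet ⊢
    exact transvectionRel_cascade (by omega) hP hQ hk0 hkn hdd hD hdet
  have hB1 : ∀ i j, 1 ≤ B.map ((↑) : ℕ → ℤ) i j := fun i j => by
    have := hpos i j
    simp only [Matrix.map_apply]
    omega
  refine (hrel.matRel (fun x y => by have := hB1 x y; omega) (cascade_nonneg hd0 _)
    ⟨k - 1, by omega⟩ (fun x => hB1 _ _) (fun y => hB1 _ _) (fun x => ?_) (fun y => ?_)).trans
    (MatRel.cascade hkn hd0 hd1 (by omega)).symm
  · have := hd1 (k - 1) (by omega)
    simp only [cascade, Matrix.of_apply]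
    grind
  · have := hd1 (k - 1) (by omega)
    have := hd1 y.1
    simp only [cascade, Matrix.of_apply]
    grind
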